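/- arXiv:1105.5471 — 2 statements merged into one kernel-verified Lean document; each statement's English description precedes it below -/
import Mathlib

section
/- Let a be an amplitude of order m′ with m′ > 0, and suppose a has a homogeneous leading term at s = 0, y = x: there exist continuous compactly supported functions ã₊, ã₋ : ℝ^n × ℝ^n → ℂ and a constant C > 0 such that |a(0,x,x,p,σ) − σ^{m′} ã₊(x,p)| ≤ C(1+σ)^{m′−1} for all σ > 0 and |a(0,x,x,p,σ) − |σ|^{m′} ã₋(x,p)| ≤ C(1+|σ|)^{m′−1} for all σ < 0, for all (x,p). Then, as ħ → 0⁺, ∫_{ℝ^n} u_ħ(x,x) dx = (2π)^{1−n} ħ^{−n−m′} ∫_{ℝ^n × ℝ^n} |p₁|^{m′} ( ã₊(x,p)·𝟙_{p₁>0} + ã₋(x,p)·𝟙_{p₁<0} ) dx dp + O(ħ^{−n−m′+1}); that is, there are constants C′ > 0 and ħ₀ > 0 such that for all 0 < ħ ≤ ħ₀ the absolute value of the difference of the two sides is at most C′ ħ^{−n−m′+1}. -/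
open MeasureTheory Real

noncomputable section

/-- An *amplitude of order `m'`* in dimension `n+1`: a smooth function
`a(s,x,y,p,σ)`, compactly supported in `(s,x,y,p)`, satisfying symbol estimates
of order `m'` in `σ`. -/
def IsAmplitude (n : ℕ) (m' : ℝ)
    (a : (ℝ × (Fin (n+1) → ℝ) × (Fin (n+1) → ℝ) × (Fin (n+1) → ℝ)) → ℝ → ℂ) : Prop :=
  ContDiff ℝ (⊤ : ℕ∞)
      (fun q : (ℝ × (Fin (n+1) → ℝ) × (Fin (n+1) → ℝ) × (Fin (n+1) → ℝ)) × ℝ => a q.1 q.2) ∧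
  (∃ K : Set (ℝ × (Fin (n+1) → ℝ) × (Fin (n+1) → ℝ) × (Fin (n+1) → ℝ)),
      IsCompact K ∧ ∀ w σ, w ∉ K → a w σ = 0) ∧
  ∀ k γ : ℕ, ∃ C : ℝ,
    ∀ w σ, ‖iteratedFDeriv ℝ k (fun w' => iteratedDeriv γ (a w') σ) w‖
      ≤ C * (1 + |σ|) ^ (m' - (γ : ℝ))

/-- The operator `1 + D_s²` where `D_s = -i ∂/∂s`, i.e. `f ↦ f - f''`. -/
def oneAddDsq (f : ℝ → ℂ) : ℝ → ℂ := fun s => f s - deriv (deriv f) s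

/-- The regularized integrand defining `u_ℏ`. -/
def oscIntegrand (n : ℕ)
    (a : (ℝ × (Fin (n+1) → ℝ) × (Fin (n+1) → ℝ) × (Fin (n+1) → ℝ)) → ℝ → ℂ)
    (ℏ : ℝ) (x y : Fin (n+1) → ℝ) (K : ℕ) :
    ℝ × (Fin (n+1) → ℝ) × ℝ → ℂ :=
  fun q =>
    Complex.exp (Complex.I *
        Complex.ofReal (ℏ⁻¹ * (∑ i, (x i - y i) * q.2.1 i) + q.1 * q.2.2)) *
    (Complex.ofReal (1 + q.2.2 ^ 2))⁻¹ ^ K *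
    (oneAddDsq^[K]
        (fun s => Complex.exp (-Complex.I * Complex.ofReal (ℏ⁻¹ * s * q.2.1 0)) *
          a (s, x, y, q.2.1) q.2.2)) q.1

/-- The kernel `u_ℏ(x,y)`, defined by the regularized oscillatory integral with
the choice `K = ⌈m'/2 + 1⌉₊` (any integer `K ≥ m'/2 + 1` gives the same value). -/
def uh (n : ℕ) (m' : ℝ)
    (a : (ℝ × (Fin (n+1) → ℝ) × (Fin (n+1) → ℝ) × (Fin (n+1) → ℝ)) → ℝ → ℂ)
    (ℏ : ℝ) (x y : Fin (n+1) → ℝ) : ℂ :=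
  Complex.ofReal ((2 * π * ℏ) ^ (-((n : ℤ) + 1))) *
    ∫ q, oscIntegrand n a ℏ x y (⌈m' / 2 + 1⌉₊) q


/-- One-dimensional Fourier transform with the sign and normalization of the paper. -/
def FT (f : ℝ → ℂ) (τ : ℝ) : ℂ := ∫ s : ℝ, Complex.exp (Complex.I * (s * τ : ℝ)) * f s

lemma FT_eq (f : ℝ → ℂ) (τ : ℝ) :
    FT f τ = FourierTransform.fourier f (-(τ / (2 * π))) := by
  rw [Real.fourier_real_eq_integral_exp_smul]
  unfold FT
  congr 1
  ext s
  rw [smul_eq_mul]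
  congr 2
  rw [mul_comm]
  congr 2
  field_simp

lemma cs_iteratedDeriv {f : ℝ → ℂ} (hs : HasCompactSupport f) (k : ℕ) :
    HasCompactSupport (iteratedDeriv k f) := by
  induction k with
  | zero => simpa [iteratedDeriv_zero] using hs
  | succ k ih => rw [iteratedDeriv_succ]; exact ih.deriv

lemma int_iteratedDeriv {f : ℝ → ℂ} (hf : ContDiff ℝ (⊤ : ℕ∞) f) (hs : HasCompactSupport f)
    (k : ℕ) : Integrable (iteratedDeriv k f) :=
  (hf.continuous_iteratedDeriv k (by exact_mod_cast le_top)).integrable_of_hasCompactSupport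
    (cs_iteratedDeriv hs k)

lemma FT_iteratedDeriv {f : ℝ → ℂ} (hf : ContDiff ℝ (⊤ : ℕ∞) f) (hs : HasCompactSupport f)
    (k : ℕ) (τ : ℝ) : FT (iteratedDeriv k f) τ = (-Complex.I * τ) ^ k * FT f τ := by
  rw [FT_eq, FT_eq, Real.fourier_iteratedDeriv (N := ⊤) hf (fun n _ => int_iteratedDeriv hf hs n)
    (by exact_mod_cast le_top)]
  simp only [smul_eq_mul]
  congr 2
  push_cast
  have : (π : ℂ) ≠ 0 := by exact_mod_cast pi_ne_zero
  field_simp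

lemma FT_norm_le {f : ℝ → ℂ} {A R : ℝ} (hR : 0 ≤ R) (hA : ∀ s, ‖f s‖ ≤ A)
    (h0 : ∀ s, R < |s| → f s = 0) (τ : ℝ) : ‖FT f τ‖ ≤ 2 * R * A := by
  unfold FT
  have : ∫ s : ℝ, Complex.exp (Complex.I * (s * τ : ℝ)) * f s
      = ∫ s in Set.Icc (-R) R, Complex.exp (Complex.I * (s * τ : ℝ)) * f s := by
    symm
    apply setIntegral_eq_integral_of_forall_compl_eq_zero
    intro s hs
    rw [h0 s, mul_zero]
    by_contra h
    exact hs (abs_le.mp (not_lt.mp h))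
  rw [this]
  have := norm_setIntegral_le_of_norm_le_const (μ := volume) (s := Set.Icc (-R) R)
    (f := fun s => Complex.exp (Complex.I * (s * τ : ℝ)) * f s) (C := A) (by simp) (by
      intro s _
      rw [norm_mul, mul_comm Complex.I, Complex.norm_exp_ofReal_mul_I, one_mul]
      exact hA s)
  refine this.trans (le_of_eq ?_)
  rw [Measure.real, Real.volume_Icc, ENNReal.toReal_ofReal (by linarith)]
  ring

lemma cs_of_zero {f : ℝ → ℂ} {R : ℝ} (h0 : ∀ s, R < |s| → f s = 0) : HasCompactSupport f := by
  apply HasCompactSupport.intro (isCompact_Icc (a := -R) (b := R))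
  intro s hs
  apply h0
  by_contra h
  exact hs (abs_le.mp (not_lt.mp h))

lemma iteratedDeriv_zero_outside {f : ℝ → ℂ} {R : ℝ} (h0 : ∀ s, R < |s| → f s = 0) (k : ℕ) :
    ∀ s, R < |s| → iteratedDeriv k f s = 0 := by
  intro s hs
  have : f =ᶠ[nhds s] (fun _ => (0 : ℂ)) := by
    have : {s : ℝ | R < |s|} ∈ nhds s :=
      (isOpen_lt continuous_const continuous_abs).mem_nhds hs
    filter_upwards [this] with t ht using h0 t ht
  rw [this.iteratedDeriv_eq]
  simp

lemma FT_decay {f : ℝ → ℂ} {A R : ℝ} (hR : 0 ≤ R) (hf : ContDiff ℝ (⊤ : ℕ∞) f)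
    (h0 : ∀ s, R < |s| → f s = 0) (k : ℕ) (hA0 : ∀ s, ‖f s‖ ≤ A)
    (hA : ∀ s, ‖iteratedDeriv k f s‖ ≤ A) (τ : ℝ) :
    ‖FT f τ‖ * (1 + |τ|) ^ k ≤ 2 ^ k * (4 * R * A) := by
  have h1 := FT_norm_le hR hA0 h0 τ
  have h2 := FT_norm_le hR hA (iteratedDeriv_zero_outside h0 k) τ
  rw [FT_iteratedDeriv hf (cs_of_zero h0), norm_mul, norm_pow, norm_mul, norm_neg,
    Complex.norm_I, one_mul, Complex.norm_real, Real.norm_eq_abs] at h2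
  have h3 : (1 + |τ|) ^ k ≤ 2 ^ k * (1 + |τ| ^ k) := by
    have hp := abs_nonneg τ
    have hpk := pow_nonneg hp k
    rcases le_total |τ| 1 with h | h
    · have : (1 + |τ|) ^ k ≤ 2 ^ k := pow_le_pow_left₀ (by linarith) (by linarith) k
      nlinarith [pow_pos (two_pos : (0:ℝ) < 2) k]
    · have : (1 + |τ|) ^ k ≤ (2 * |τ|) ^ k := pow_le_pow_left₀ (by linarith) (by linarith) k
      rw [mul_pow] at this
      nlinarith [pow_pos (two_pos : (0:ℝ) < 2) k]
  calc ‖FT f τ‖ * (1 + |τ|) ^ k ≤ ‖FT f τ‖ * (2 ^ k * (1 + |τ| ^ k)) := by gcongr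
    _ = 2 ^ k * (‖FT f τ‖ + |τ| ^ k * ‖FT f τ‖) := by ring
    _ ≤ 2 ^ k * (4 * R * A) := by gcongr; linarith

lemma FT_continuous {f : ℝ → ℂ} (hf : Integrable f) : Continuous (FT f) := by
  have h : Continuous (FourierTransform.fourier f) :=
    VectorFourier.fourierIntegral_continuous Real.continuous_fourierChar
      (by exact (innerSL ℝ).continuous₂) hf
  have : FT f = fun τ => FourierTransform.fourier f (-(τ / (2 * π))) := by
    ext τ; exact FT_eq f τ
  rw [this]
  fun_prop

lemma integrable_decay : Integrable (fun τ : ℝ => ((1 + |τ|) ^ 2)⁻¹) := by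
  have := integrable_one_add_norm (E := ℝ) (μ := volume) (r := 2) (by simp)
  refine this.congr (Filter.Eventually.of_forall fun x => ?_)
  simp only [Real.norm_eq_abs]
  rw [rpow_neg (by positivity)]
  norm_num

lemma FT_integrable {f : ℝ → ℂ} (hf : ContDiff ℝ (⊤ : ℕ∞) f) {R : ℝ} (hR : 0 ≤ R)
    (h0 : ∀ s, R < |s| → f s = 0) : Integrable (FT f) := by
  have hs := cs_of_zero h0
  obtain ⟨A1, h1⟩ := hf.continuous.bounded_above_of_compact_support hs
  obtain ⟨A2, h2⟩ := (hf.continuous_iteratedDeriv 2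
    (WithTop.coe_le_coe.mpr le_top)).bounded_above_of_compact_support (cs_iteratedDeriv hs 2)
  have hd := FT_decay hR hf h0 2 (A := max A1 A2) (fun s => (h1 s).trans (le_max_left _ _))
    (fun s => (h2 s).trans (le_max_right _ _))
  refine (integrable_decay.const_mul (2 ^ 2 * (4 * R * max A1 A2))).mono'
    (FT_continuous (hf.continuous.integrable_of_hasCompactSupport hs)).aestronglyMeasurable ?_
  refine Filter.Eventually.of_forall fun τ => ?_
  rw [← div_eq_mul_inv, le_div_iff₀ (by positivity)]
  exact hd τ

lemma FT_inversion {f : ℝ → ℂ} (hf : ContDiff ℝ (⊤ : ℕ∞) f) {R : ℝ} (hR : 0 ≤ R)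
    (h0 : ∀ s, R < |s| → f s = 0) : ∫ τ, FT f τ = 2 * π * f 0 := by
  have hi := FT_integrable hf hR h0
  have hF : FourierTransform.fourier f = fun x => FT f ((-(2 * π)) * x) := by
    ext x
    rw [FT_eq]
    field_simp
  have h := Integrable.fourierInv_fourier_eq (f := f) (v := 0)
    (hf.continuous.integrable_of_hasCompactSupport (cs_of_zero h0))
    (by
      rw [hF]
      exact hi.comp_mul_left' (by simp [pi_ne_zero])) hf.continuous.continuousAt
  rw [Real.fourierInv_eq'] at h
  simp only [inner_zero_right, mul_zero, Complex.ofReal_zero, zero_mul, Complex.exp_zero,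
    one_smul] at h
  rw [hF, Measure.integral_comp_mul_left] at h
  rw [← h, abs_inv, abs_neg, abs_of_pos (by positivity), Complex.real_smul]
  push_cast
  have : (π : ℂ) ≠ 0 := by exact_mod_cast pi_ne_zero
  field_simp

lemma oneAddDsq_contDiff {f : ℝ → ℂ} (hf : ContDiff ℝ (⊤ : ℕ∞) f) :
    ContDiff ℝ (⊤ : ℕ∞) (oneAddDsq f) := by
  unfold oneAddDsq
  have h1 : ContDiff ℝ (⊤ : ℕ∞) (deriv f) := (contDiff_infty_iff_deriv.mp hf).2
  exact hf.sub (contDiff_infty_iff_deriv.mp h1).2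

lemma FT_oneAddDsq_iterate (K : ℕ) {f : ℝ → ℂ} (hf : ContDiff ℝ (⊤ : ℕ∞) f)
    (hs : HasCompactSupport f) (τ : ℝ) :
    FT (oneAddDsq^[K] f) τ = ((1 + τ ^ 2 : ℝ) : ℂ) ^ K * FT f τ := by
  induction K generalizing f with
  | zero => simp
  | succ K ih =>
    rw [Function.iterate_succ_apply, ih (oneAddDsq_contDiff hf)
      (by unfold oneAddDsq; exact hs.sub hs.deriv.deriv), pow_succ _ K, mul_assoc]
    congr 1
    have h2 := FT_iteratedDeriv hf hs 2 τ
    have e : iteratedDeriv 2 f = deriv (deriv f) := by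
      rw [iteratedDeriv_succ, iteratedDeriv_one]
    have hkint : ∀ g : ℝ → ℂ, Integrable g →
        Integrable (fun s : ℝ => Complex.exp (Complex.I * (s * τ : ℝ)) * g s) := by
      intro g hg
      refine hg.bdd_mul (c := 1) (by fun_prop) (Filter.Eventually.of_forall fun s => ?_)
      rw [mul_comm Complex.I, Complex.norm_exp_ofReal_mul_I]
    have : FT (oneAddDsq f) τ = FT f τ - FT (iteratedDeriv 2 f) τ := by
      unfold FT oneAddDsq
      rw [← integral_sub]
      · congr 1; ext s; rw [e]; ring
      · exact hkint _ (hf.continuous.integrable_of_hasCompactSupport hs)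
      · exact hkint _ (int_iteratedDeriv hf hs 2)
    rw [this, h2]
    push_cast
    ring_nf
    rw [Complex.I_sq]
    ring

lemma peetre (r l x t : ℝ) (h : |x - l| ≤ t) :
    (1 + |x|) ^ r ≤ (1 + |l|) ^ r * (1 + t) ^ |r| := by
  have ht : 0 ≤ t := (abs_nonneg _).trans h
  have h1 : 1 + |x| ≤ (1 + |l|) * (1 + t) := by
    have : |x| ≤ |l| + t := by
      have := abs_add_le (x - l) l
      rw [sub_add_cancel] at this
      linarith
    nlinarith [abs_nonneg l]
  have h2 : 1 + |l| ≤ (1 + |x|) * (1 + t) := by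
    have : |l| ≤ |x| + t := by
      have := abs_add_le (l - x) x
      rw [sub_add_cancel, abs_sub_comm] at this
      linarith
    nlinarith [abs_nonneg x]
  rcases le_total 0 r with hr | hr
  · rw [abs_of_nonneg hr, ← mul_rpow (by positivity) (by positivity)]
    exact rpow_le_rpow (by positivity) h1 hr
  · rw [abs_of_nonpos hr, rpow_neg (by positivity), ← div_eq_mul_inv,
      ← div_rpow (by positivity) (by positivity)]
    apply rpow_le_rpow_of_nonpos (by positivity) _ hr
    rw [div_le_iff₀ (by positivity)]
    exact h2

/-- Derivative in the parameter `σ` of the slice Fourier transform. -/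
lemma FT_hasDerivAt {g : ℝ → ℝ → ℂ} {R : ℝ}
    (hg : ContDiff ℝ (⊤ : ℕ∞) (fun q : ℝ × ℝ => g q.1 q.2))
    (h0 : ∀ s σ, R < |s| → g s σ = 0) (τ σ : ℝ) :
    HasDerivAt (fun σ => FT (fun s => g s σ) τ) (FT (fun s => deriv (g s) σ) τ) σ := by
  have hd : ∀ s σ, HasDerivAt (g s) (deriv (g s) σ) σ := by
    intro s σ
    have : DifferentiableAt ℝ (g s) σ := by
      have h := (hg.differentiable (by simp)).comp
        (f := fun t : ℝ => (s, t)) (by fun_prop)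
      exact h σ
    exact this.hasDerivAt
  have hd0 : ∀ s σ, R < |s| → deriv (g s) σ = 0 := by
    intro s σ hs
    have : g s = fun _ => 0 := by ext t; exact h0 s t hs
    rw [this]; simp
  have hdc : Continuous (fun q : ℝ × ℝ => deriv (g q.1) q.2) := by
    have e : (fun q : ℝ × ℝ => deriv (g q.1) q.2)
        = fun q => fderiv ℝ (fun q : ℝ × ℝ => g q.1 q.2) q (0, 1) := by
      ext q
      have h1 : HasFDerivAt (fun q : ℝ × ℝ => g q.1 q.2) _ (q.1, q.2) :=
        ((hg.differentiable (by simp)) q).hasFDerivAt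
      have h2 : HasDerivAt (fun t : ℝ => (q.1, t)) ((0 : ℝ), (1 : ℝ)) q.2 :=
        (hasDerivAt_const _ _).prodMk (hasDerivAt_id _)
      exact (h1.comp_hasDerivAt q.2 h2).deriv
    rw [e]
    exact (hg.continuous_fderiv (by simp)).clm_apply continuous_const
  obtain ⟨M, hM⟩ := ((isCompact_Icc (a := -R) (b := R)).prod
    (isCompact_Icc (a := σ - 1) (b := σ + 1))).exists_bound_of_continuousOn hdc.continuousOn
  have hcont : ∀ σ, Continuous (fun s => g s σ) := fun σ =>
    hg.continuous.comp (f := fun s : ℝ => (s, σ)) (by fun_prop)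
  have hcontd : ∀ σ, Continuous (fun s => deriv (g s) σ) := fun σ =>
    hdc.comp (f := fun s : ℝ => (s, σ)) (by fun_prop)
  unfold FT
  refine (hasDerivAt_integral_of_dominated_loc_of_deriv_le (𝕜 := ℝ)
    (F := fun σ s => Complex.exp (Complex.I * (s * τ : ℝ)) * g s σ)
    (F' := fun σ s => Complex.exp (Complex.I * (s * τ : ℝ)) * deriv (g s) σ)
    (s := Set.Icc (σ - 1) (σ + 1))
    (bound := (Set.Icc (-R) R).indicator fun _ => M)
    (Icc_mem_nhds (by linarith) (by linarith)) ?_ ?_ ?_ ?_ ?_ ?_).2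
  · refine Filter.Eventually.of_forall fun x => ?_
    have := hcont x
    exact Continuous.aestronglyMeasurable (by fun_prop)
  · have := hcont σ
    refine Continuous.integrable_of_hasCompactSupport (by fun_prop) ?_
    exact (cs_of_zero (fun s => h0 s σ)).mul_left
  · have := hcontd σ
    exact Continuous.aestronglyMeasurable (by fun_prop)
  · refine Filter.Eventually.of_forall fun s x hx => ?_
    rw [norm_mul, mul_comm Complex.I, Complex.norm_exp_ofReal_mul_I, one_mul]
    by_cases hs : s ∈ Set.Icc (-R) R
    · rw [Set.indicator_of_mem hs]
      exact hM (s, x) ⟨hs, hx⟩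
    · rw [Set.indicator_of_notMem hs, hd0 s x, norm_zero]
      by_contra h
      exact hs (abs_le.mp (not_lt.mp h))
  · exact (integrable_indicator_iff measurableSet_Icc).mpr (by simp)
  · refine Filter.Eventually.of_forall fun s x hx => ?_
    exact (hd s x).const_mul _

lemma deriv_slice_contDiff {g : ℝ → ℝ → ℂ}
    (hg : ContDiff ℝ (⊤ : ℕ∞) (fun q : ℝ × ℝ => g q.1 q.2)) (σ : ℝ) :
    ContDiff ℝ (⊤ : ℕ∞) (fun s => deriv (g s) σ) := by
  have e : (fun s : ℝ => deriv (g s) σ)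
      = fun s => fderiv ℝ (fun q : ℝ × ℝ => g q.1 q.2) (s, σ) (0, 1) := by
    ext s
    have h1 : HasFDerivAt (fun q : ℝ × ℝ => g q.1 q.2) _ (s, σ) :=
      ((hg.differentiable (by simp)) (s, σ)).hasFDerivAt
    have h2 : HasDerivAt (fun t : ℝ => (s, t)) ((0 : ℝ), (1 : ℝ)) σ :=
      (hasDerivAt_const _ _).prodMk (hasDerivAt_id _)
    exact (h1.comp_hasDerivAt σ h2).deriv
  rw [e]
  have : ContDiff ℝ (⊤ : ℕ∞) (fderiv ℝ (fun q : ℝ × ℝ => g q.1 q.2)) :=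
    hg.fderiv_right (by simp)
  exact (this.comp (by fun_prop : ContDiff ℝ (⊤ : ℕ∞) (fun s : ℝ => (s, σ)))).clm_apply
    contDiff_const

lemma core (m R A : ℝ) (hR : 0 ≤ R) (hA : 0 ≤ A) : ∃ C : ℝ, 0 ≤ C ∧ ∀ (g : ℝ → ℝ → ℂ),
    ContDiff ℝ (⊤ : ℕ∞) (fun q : ℝ × ℝ => g q.1 q.2) →
    (∀ s σ, R < |s| → g s σ = 0) →
    (∀ s σ, ‖deriv (g s) σ‖ ≤ A * (1 + |σ|) ^ (m - 1)) →
    (∀ s σ, ‖iteratedDeriv (⌈|m - 1|⌉₊ + 3) (fun s => deriv (g s) σ) s‖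
      ≤ A * (1 + |σ|) ^ (m - 1)) →
    ∀ l : ℝ, ‖(∫ σ, FT (fun s => g s σ) (σ - l)) - 2 * π * g 0 l‖ ≤ C * (1 + |l|) ^ (m - 1) := by
  set N := ⌈|m - 1|⌉₊ + 3 with hN
  refine ⟨2 ^ N * (4 * R * A) * ∫ τ : ℝ, ((1 + |τ|) ^ 2)⁻¹, by positivity, ?_⟩
  intro g hg h0 hb0 hbN l
  have hd0 : ∀ σ s, R < |s| → deriv (g s) σ = 0 := by
    intro σ s hs
    have : g s = fun _ => 0 := by ext t; exact h0 s t hs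
    rw [this]; simp
  have hslice : ∀ σ, ContDiff ℝ (⊤ : ℕ∞) (fun s => g s σ) := fun σ =>
    hg.comp (by fun_prop : ContDiff ℝ (⊤ : ℕ∞) (fun s : ℝ => (s, σ)))
  -- bound of the parameter derivative
  have hder : ∀ τ σ, ‖FT (fun s => deriv (g s) σ) τ‖ * (1 + |τ|) ^ N
      ≤ 2 ^ N * (4 * R * (A * (1 + |σ|) ^ (m - 1))) := fun τ σ =>
    FT_decay hR (deriv_slice_contDiff hg σ) (hd0 σ) N (fun s => hb0 s σ) (fun s => hbN s σ) τ
  have hdiff : ∀ σ, ‖FT (fun s => g s σ) (σ - l) - FT (fun s => g s l) (σ - l)‖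
      ≤ (2 ^ N * (4 * R * A) * (1 + |l|) ^ (m - 1)) * ((1 + |σ - l|) ^ 2)⁻¹ := by
    intro σ
    set τ := σ - l with hτ
    have hb : ∀ x ∈ Set.uIcc l σ, ‖FT (fun s => deriv (g s) x) τ‖
        ≤ (2 ^ N * (4 * R * A) * (1 + |l|) ^ (m - 1)) * ((1 + |τ|) ^ 3)⁻¹ := by
      intro x hx
      have hx' : |x - l| ≤ |τ| := Set.abs_sub_left_of_mem_uIcc hx
      have hp := peetre (m - 1) l x |τ| hx'
      have hq : (1 + |τ|) ^ |m - 1| ≤ (1 + |τ|) ^ (⌈|m - 1|⌉₊) := by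
        rw [← rpow_natCast]
        exact rpow_le_rpow_of_exponent_le (by linarith [abs_nonneg τ]) (Nat.le_ceil _)
      have h1 := hder τ x
      rw [← div_eq_mul_inv, le_div_iff₀ (by positivity)]
      have hpos : 0 < (1 + |τ|) ^ (⌈|m - 1|⌉₊) := by positivity
      refine le_of_mul_le_mul_right ?_ hpos
      calc ‖FT (fun s => deriv (g s) x) τ‖ * (1 + |τ|) ^ 3 * (1 + |τ|) ^ (⌈|m - 1|⌉₊)
          = ‖FT (fun s => deriv (g s) x) τ‖ * (1 + |τ|) ^ N := by rw [hN, pow_add]; ring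
        _ ≤ 2 ^ N * (4 * R * (A * (1 + |x|) ^ (m - 1))) := h1
        _ ≤ 2 ^ N * (4 * R * (A * ((1 + |l|) ^ (m - 1) * (1 + |τ|) ^ (⌈|m - 1|⌉₊)))) := by
            gcongr
            exact hp.trans (by gcongr)
        _ = _ := by ring
    have := (convex_uIcc l σ).norm_image_sub_le_of_norm_hasDerivWithin_le
      (f := fun σ => FT (fun s => g s σ) τ) (x := l) (y := σ)
      (fun x _ => (FT_hasDerivAt hg h0 τ x).hasDerivWithinAt) hb
      Set.left_mem_uIcc Set.right_mem_uIcc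
    refine this.trans ?_
    rw [Real.norm_eq_abs, ← hτ, mul_assoc]
    have hP : 0 ≤ 2 ^ N * (4 * R * A) * (1 + |l|) ^ (m - 1) := by positivity
    refine mul_le_mul_of_nonneg_left ?_ hP
    rw [inv_mul_le_iff₀ (by positivity)]
    have : (1 + |τ|) ^ 3 * ((1 + |τ|) ^ 2)⁻¹ = 1 + |τ| := by field_simp
    linarith
  have hI1 : Integrable (fun σ => FT (fun s => g s l) (σ - l)) :=
    (FT_integrable (hslice l) hR (fun s => h0 s l)).comp_sub_right l
  have hcont : Continuous (fun σ => FT (fun s => g s σ) (σ - l)) := by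
    unfold FT
    rw [← continuousOn_univ]
    have hgc := hg.continuous
    refine continuousOn_integral_of_compact_support (isCompact_Icc (a := -R) (b := R)) ?_ ?_
    · apply Continuous.continuousOn
      have : Continuous (fun q : ℝ × ℝ => g q.2 q.1) :=
        hgc.comp (continuous_snd.prodMk continuous_fst)
      unfold Function.uncurry
      fun_prop
    · intro σ s _ hs
      show _ * g s σ = 0
      rw [h0 s σ, mul_zero]
      by_contra h
      exact hs (abs_le.mp (not_lt.mp h))
  have hbi : Integrable (fun σ => (2 ^ N * (4 * R * A) * (1 + |l|) ^ (m - 1))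
      * ((1 + |σ - l|) ^ 2)⁻¹) := (integrable_decay.comp_sub_right l).const_mul _
  have hI2 : Integrable (fun σ => FT (fun s => g s σ) (σ - l) - FT (fun s => g s l) (σ - l)) :=
    hbi.mono' (hcont.aestronglyMeasurable.sub hI1.aestronglyMeasurable)
      (Filter.Eventually.of_forall hdiff)
  have e1 : ∫ σ, FT (fun s => g s σ) (σ - l)
      = (∫ σ, (FT (fun s => g s σ) (σ - l) - FT (fun s => g s l) (σ - l))) + 2 * π * g 0 l := by
    rw [← FT_inversion (hslice l) hR (fun s => h0 s l), ← integral_sub_right_eq_self (FT fun s => g s l) l,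
      ← integral_add hI2 hI1]
    simp
  rw [e1, add_sub_cancel_right]
  refine (norm_integral_le_of_norm_le hbi (Filter.Eventually.of_forall hdiff)).trans (le_of_eq ?_)
  rw [integral_const_mul, integral_sub_right_eq_self (fun τ : ℝ => ((1 + |τ|) ^ 2)⁻¹) l]
  ring

/-- Symbols on the full integration space `(x, s, p, σ)`. -/
structure SymbCls (n : ℕ) (m R : ℝ)
    (G : (Fin (n+1) → ℝ) × (ℝ × ((Fin (n+1) → ℝ) × ℝ)) → ℂ) : Prop where
  smooth : ContDiff ℝ (⊤ : ℕ∞) G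
  supp : ∀ x s p σ, (R < ‖x‖ ∨ R < |s| ∨ R < ‖p‖) → G (x, s, p, σ) = 0
  bound : ∀ j : ℕ, ∃ C : ℝ, 0 ≤ C ∧ ∀ x s p σ,
    ‖iteratedDeriv j (fun s => G (x, s, p, σ)) s‖ ≤ C * (1 + |σ|) ^ m

/-- The `s`-derivative. -/
def dS (n : ℕ) (G : (Fin (n+1) → ℝ) × (ℝ × ((Fin (n+1) → ℝ) × ℝ)) → ℂ) :
    (Fin (n+1) → ℝ) × (ℝ × ((Fin (n+1) → ℝ) × ℝ)) → ℂ :=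
  fun v => fderiv ℝ G v (0, (1, (0, 0)))

lemma hasDerivAt_dS {n : ℕ} {G : (Fin (n+1) → ℝ) × (ℝ × ((Fin (n+1) → ℝ) × ℝ)) → ℂ}
    (hG : ContDiff ℝ (⊤ : ℕ∞) G) (x : Fin (n+1) → ℝ) (s : ℝ) (p : Fin (n+1) → ℝ) (σ : ℝ) :
    HasDerivAt (fun s => G (x, s, p, σ)) (dS n G (x, s, p, σ)) s := by
  have h1 : HasFDerivAt G _ (x, s, p, σ) :=
    ((hG.differentiable (by simp)) (x, s, p, σ)).hasFDerivAt
  have h2 : HasDerivAt (fun t : ℝ => (x, t, p, σ)) (0, (1, (0, 0))) s :=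
    (hasDerivAt_const _ _).prodMk ((hasDerivAt_id _).prodMk (hasDerivAt_const _ _))
  exact h1.comp_hasDerivAt s h2

lemma slice_contDiff {n : ℕ} {G : (Fin (n+1) → ℝ) × (ℝ × ((Fin (n+1) → ℝ) × ℝ)) → ℂ}
    (hG : ContDiff ℝ (⊤ : ℕ∞) G) (x : Fin (n+1) → ℝ) (p : Fin (n+1) → ℝ) (σ : ℝ) :
    ContDiff ℝ (⊤ : ℕ∞) (fun s => G (x, s, p, σ)) :=
  hG.comp (by fun_prop : ContDiff ℝ (⊤ : ℕ∞) (fun s : ℝ => (x, s, p, σ)))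

lemma SymbCls.dS {n : ℕ} {m R : ℝ} {G : (Fin (n+1) → ℝ) × (ℝ × ((Fin (n+1) → ℝ) × ℝ)) → ℂ}
    (hG : SymbCls n m R G) : SymbCls n m R (dS n G) := by
  have hsl : ∀ x p σ, (fun s => _root_.dS n G (x, s, p, σ)) = deriv (fun s => G (x, s, p, σ)) := by
    intro x p σ; ext s; exact (hasDerivAt_dS hG.smooth x s p σ).deriv.symm
  refine ⟨?_, ?_, ?_⟩
  · have : ContDiff ℝ (⊤ : ℕ∞) (fderiv ℝ G) := hG.smooth.fderiv_right (by simp)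
    exact this.clm_apply contDiff_const
  · intro x s p σ h
    have e := congrFun (hsl x p σ) s
    rw [e]
    by_cases hs : R < |s|
    · have := iteratedDeriv_zero_outside (f := fun s => G (x, s, p, σ)) (R := R)
        (fun s hs => hG.supp x s p σ (Or.inr (Or.inl hs))) 1 s hs
      rwa [iteratedDeriv_one] at this
    · have : (fun s => G (x, s, p, σ)) = fun _ => 0 := by
        ext t; exact hG.supp x t p σ (by tauto)
      rw [this]; simp
  · intro j
    obtain ⟨C, hC, h⟩ := hG.bound (j + 1)
    refine ⟨C, hC, fun x s p σ => ?_⟩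
    have := h x s p σ
    rwa [iteratedDeriv_succ', ← hsl] at this

lemma SymbCls.sub {n : ℕ} {m R : ℝ} {G H : (Fin (n+1) → ℝ) × (ℝ × ((Fin (n+1) → ℝ) × ℝ)) → ℂ}
    (hG : SymbCls n m R G) (hH : SymbCls n m R H) : SymbCls n m R (fun v => G v - H v) := by
  refine ⟨hG.smooth.sub hH.smooth, fun x s p σ h => ?_, fun j => ?_⟩
  · simp only [hG.supp x s p σ h, hH.supp x s p σ h, sub_zero]
  · obtain ⟨C, hC, h⟩ := hG.bound j
    obtain ⟨C', hC', h'⟩ := hH.bound j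
    refine ⟨C + C', by positivity, fun x s p σ => ?_⟩
    have e := iteratedDeriv_fun_sub (n := j) (x := s)
      ((slice_contDiff hG.smooth x p σ).of_le (m := j) (WithTop.coe_le_coe.mpr le_top)).contDiffAt
      ((slice_contDiff hH.smooth x p σ).of_le (m := j) (WithTop.coe_le_coe.mpr le_top)).contDiffAt
    rw [e, add_mul]
    exact (norm_sub_le _ _).trans (add_le_add (h x s p σ) (h' x s p σ))

lemma SymbCls.mul {n : ℕ} {m R : ℝ} (hR : 0 ≤ R)
    {G : (Fin (n+1) → ℝ) × (ℝ × ((Fin (n+1) → ℝ) × ℝ)) → ℂ}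
    (hG : SymbCls n m R G) (c : ℂ) : SymbCls n m R (fun v => (c * (v.2.2.1 0 : ℝ)) * G v) := by
  refine ⟨?_, fun x s p σ h => ?_, fun j => ?_⟩
  · refine ContDiff.mul (contDiff_const.mul ?_) hG.smooth
    have h0 : ContDiff ℝ (⊤ : ℕ∞)
        (fun v : (Fin (n+1) → ℝ) × (ℝ × ((Fin (n+1) → ℝ) × ℝ)) => v.2.2.1 0) := by fun_prop
    exact Complex.ofRealCLM.contDiff.comp h0
  · simp only [hG.supp x s p σ h, mul_zero]
  · obtain ⟨C, hC, h⟩ := hG.bound j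
    refine ⟨‖c‖ * R * C, by positivity, fun x s p σ => ?_⟩
    have e := iteratedDeriv_const_mul (n := j) (x := s) (c * (p 0 : ℝ))
      ((slice_contDiff hG.smooth x p σ).of_le (m := j) (WithTop.coe_le_coe.mpr le_top)).contDiffAt
    simp only
    rw [e]
    by_cases hp : R < ‖p‖
    · have : (fun s => G (x, s, p, σ)) = fun _ => 0 := by
        ext t; exact hG.supp x t p σ (by tauto)
      rw [this]
      simp
      positivity
    · rw [norm_mul, norm_mul, Complex.norm_real, mul_assoc (‖c‖ * R)]
      gcongr
      · exact (norm_le_pi_norm p 0).trans (not_lt.mp hp)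
      · exact h x s p σ

/-- The conjugated derivative `∂_s - i p₁/ℏ`. -/
def dL (n : ℕ) (ℏ : ℝ) (G : (Fin (n+1) → ℝ) × (ℝ × ((Fin (n+1) → ℝ) × ℝ)) → ℂ) :
    (Fin (n+1) → ℝ) × (ℝ × ((Fin (n+1) → ℝ) × ℝ)) → ℂ :=
  fun v => dS n G v - ((Complex.I * (ℏ⁻¹ : ℝ)) * (v.2.2.1 0 : ℝ)) * G v

/-- The conjugated operator `1 + (D_s - p₁/ℏ)²`. -/
def tL (n : ℕ) (ℏ : ℝ) (G : (Fin (n+1) → ℝ) × (ℝ × ((Fin (n+1) → ℝ) × ℝ)) → ℂ) :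
    (Fin (n+1) → ℝ) × (ℝ × ((Fin (n+1) → ℝ) × ℝ)) → ℂ :=
  fun v => G v - dL n ℏ (dL n ℏ G) v

lemma SymbCls.dL {n : ℕ} {m R : ℝ} (hR : 0 ≤ R) (ℏ : ℝ)
    {G : (Fin (n+1) → ℝ) × (ℝ × ((Fin (n+1) → ℝ) × ℝ)) → ℂ}
    (hG : SymbCls n m R G) : SymbCls n m R (dL n ℏ G) := hG.dS.sub (hG.mul hR _)

lemma SymbCls.tL {n : ℕ} {m R : ℝ} (hR : 0 ≤ R) (ℏ : ℝ)
    {G : (Fin (n+1) → ℝ) × (ℝ × ((Fin (n+1) → ℝ) × ℝ)) → ℂ}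
    (hG : SymbCls n m R G) : SymbCls n m R (tL n ℏ G) := hG.sub ((hG.dL hR ℏ).dL hR ℏ)

lemma deriv_exp_mul {n : ℕ} (ℏ : ℝ) {G : (Fin (n+1) → ℝ) × (ℝ × ((Fin (n+1) → ℝ) × ℝ)) → ℂ}
    (hG : ContDiff ℝ (⊤ : ℕ∞) G) (x p : Fin (n+1) → ℝ) (σ : ℝ) :
    deriv (fun s : ℝ => Complex.exp (-Complex.I * Complex.ofReal (ℏ⁻¹ * s * p 0)) * G (x, s, p, σ))
      = fun s : ℝ => Complex.exp (-Complex.I * Complex.ofReal (ℏ⁻¹ * s * p 0)) *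
          dL n ℏ G (x, s, p, σ) := by
  ext s
  have h1 := hasDerivAt_dS hG x s p σ
  have h0 : HasDerivAt (fun s : ℝ => -Complex.I * Complex.ofReal (ℏ⁻¹ * s * p 0))
      (-Complex.I * Complex.ofReal (ℏ⁻¹ * 1 * p 0)) s :=
    ((((hasDerivAt_id s).const_mul ℏ⁻¹).mul_const (p 0)).ofReal_comp).const_mul _
  refine (h0.cexp.mul h1).deriv.trans ?_
  simp only [_root_.dL]
  push_cast
  ring

lemma oneAddDsq_iterate_exp {n : ℕ} {m R : ℝ} (hR : 0 ≤ R) (ℏ : ℝ) (K : ℕ)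
    {G : (Fin (n+1) → ℝ) × (ℝ × ((Fin (n+1) → ℝ) × ℝ)) → ℂ}
    (hG : SymbCls n m R G) (x p : Fin (n+1) → ℝ) (σ : ℝ) :
    oneAddDsq^[K] (fun s : ℝ => Complex.exp (-Complex.I * Complex.ofReal (ℏ⁻¹ * s * p 0)) *
        G (x, s, p, σ))
      = fun s : ℝ => Complex.exp (-Complex.I * Complex.ofReal (ℏ⁻¹ * s * p 0)) *
          ((tL n ℏ)^[K] G) (x, s, p, σ) := by
  induction K generalizing G with
  | zero => rfl
  | succ K ih =>
    rw [Function.iterate_succ_apply, Function.iterate_succ_apply, ← ih (hG.tL hR ℏ)]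
    congr 1
    unfold oneAddDsq
    rw [deriv_exp_mul ℏ hG.smooth, deriv_exp_mul ℏ (hG.dL hR ℏ).smooth]
    ext s
    simp only [_root_.tL]
    ring

lemma SymbCls.iterate {n : ℕ} {m R : ℝ} (hR : 0 ≤ R) (ℏ : ℝ) (K : ℕ)
    {G : (Fin (n+1) → ℝ) × (ℝ × ((Fin (n+1) → ℝ) × ℝ)) → ℂ}
    (hG : SymbCls n m R G) : SymbCls n m R ((_root_.tL n ℏ)^[K] G) := by
  induction K generalizing G with
  | zero => exact hG
  | succ K ih => rw [Function.iterate_succ_apply]; exact ih (hG.tL hR ℏ)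

/-- Absolute integrability of the regularized integrand in all variables. -/
lemma integrand_integrable {n : ℕ} {m R : ℝ} (hR : 0 ≤ R) (ℏ : ℝ) (K : ℕ) (hK : m / 2 + 1 ≤ K)
    {G : (Fin (n+1) → ℝ) × (ℝ × ((Fin (n+1) → ℝ) × ℝ)) → ℂ} (hG : SymbCls n m R G) :
    Integrable (fun v : (Fin (n+1) → ℝ) × (ℝ × ((Fin (n+1) → ℝ) × ℝ)) =>
      Complex.exp (Complex.I * (v.2.1 * v.2.2.2 : ℝ)) *
      (Complex.ofReal (1 + v.2.2.2 ^ 2))⁻¹ ^ K *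
      (oneAddDsq^[K] (fun s : ℝ =>
        Complex.exp (-Complex.I * Complex.ofReal (ℏ⁻¹ * s * v.2.2.1 0)) *
        G (v.1, s, v.2.2.1, v.2.2.2))) v.2.1) := by
  have hT := hG.iterate hR ℏ K
  obtain ⟨C, hC, hb⟩ := hT.bound 0
  simp only [iteratedDeriv_zero] at hb
  simp only [oneAddDsq_iterate_exp hR ℏ K hG]
  have hTc := hT.smooth.continuous
  have hX : Integrable ((Metric.closedBall (0 : Fin (n+1) → ℝ) R).indicator fun _ => (1 : ℝ)) :=
    (integrable_indicator_iff Metric.isClosed_closedBall.measurableSet).mpr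
      (integrableOn_const (isCompact_closedBall _ _).measure_lt_top.ne)
  have hS : Integrable ((Metric.closedBall (0 : ℝ) R).indicator fun _ => (1 : ℝ)) :=
    (integrable_indicator_iff Metric.isClosed_closedBall.measurableSet).mpr
      (integrableOn_const (isCompact_closedBall _ _).measure_lt_top.ne)
  have hD := (hX.mul_prod (hS.mul_prod (hX.mul_prod (integrable_decay.const_mul (C * 2 ^ K)))))
  refine hD.mono' ?_ (Filter.Eventually.of_forall ?_)
  · apply Continuous.aestronglyMeasurable
    have hc1 : Continuous (fun v : (Fin (n+1) → ℝ) × (ℝ × ((Fin (n+1) → ℝ) × ℝ)) =>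
        (Complex.ofReal (1 + v.2.2.2 ^ 2))⁻¹) := by
      refine Continuous.inv₀ (by fun_prop) fun v => ?_
      have : (1 + v.2.2.2 ^ 2 : ℝ) ≠ 0 := by positivity
      exact_mod_cast this
    have hc2 : Continuous (fun v : (Fin (n+1) → ℝ) × (ℝ × ((Fin (n+1) → ℝ) × ℝ)) =>
        ((tL n ℏ)^[K] G) (v.1, v.2.1, v.2.2.1, v.2.2.2)) := hTc
    fun_prop
  · rintro ⟨x, s, p, σ⟩
    simp only
    have hn : ‖Complex.exp (Complex.I * (s * σ : ℝ)) * (Complex.ofReal (1 + σ ^ 2))⁻¹ ^ K *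
        (Complex.exp (-Complex.I * Complex.ofReal (ℏ⁻¹ * s * p 0)) *
          ((tL n ℏ)^[K] G) (x, s, p, σ))‖
        = ((1 + σ ^ 2)⁻¹) ^ K * ‖((tL n ℏ)^[K] G) (x, s, p, σ)‖ := by
      rw [norm_mul, norm_mul, norm_mul, mul_comm Complex.I, Complex.norm_exp_ofReal_mul_I,
        neg_mul, ← mul_neg, ← Complex.ofReal_neg, mul_comm Complex.I,
        Complex.norm_exp_ofReal_mul_I, norm_pow, norm_inv, Complex.norm_real,
        Real.norm_of_nonneg (by positivity), one_mul, one_mul]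
    rw [hn]
    by_cases hbox : R < ‖x‖ ∨ R < |s| ∨ R < ‖p‖
    · rw [hT.supp x s p σ hbox]
      simp only [norm_zero, mul_zero]
      have i1 := Set.indicator_nonneg (s := Metric.closedBall (0 : Fin (n+1) → ℝ) R)
        (f := fun _ => (1 : ℝ)) (fun _ _ => zero_le_one)
      have i2 := Set.indicator_nonneg (s := Metric.closedBall (0 : ℝ) R)
        (f := fun _ => (1 : ℝ)) (fun _ _ => zero_le_one)
      exact mul_nonneg (i1 x) (mul_nonneg (i2 s) (mul_nonneg (i1 p) (by positivity)))
    · push Not at hbox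
      rw [Set.indicator_of_mem (by simpa using hbox.1),
        Set.indicator_of_mem (by simpa using hbox.2.1),
        Set.indicator_of_mem (by simpa using hbox.2.2), one_mul, one_mul, one_mul]
      have h1 := hb x s p σ
      have hs1 : 1 ≤ 1 + |σ| := by linarith [abs_nonneg σ]
      have h2 : (1 + |σ|) ^ m ≤ ((1 + |σ|) ^ 2) ^ K * ((1 + |σ|) ^ 2)⁻¹ := by
        rw [← div_eq_mul_inv, le_div_iff₀ (by positivity), ← pow_mul, ← rpow_natCast _ (2 * K),
          ← rpow_natCast _ 2, ← rpow_add (by positivity)]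
        apply rpow_le_rpow_of_exponent_le hs1
        push_cast
        linarith
      have h3 : (1 + |σ|) ^ 2 ≤ 2 * (1 + σ ^ 2) := by
        rw [← sq_abs σ]; nlinarith [sq_nonneg (1 - |σ|)]
      have h4 : ((1 + |σ|) ^ 2) ^ K ≤ 2 ^ K * (1 + σ ^ 2) ^ K := by
        rw [← mul_pow]; exact pow_le_pow_left₀ (by positivity) h3 K
      calc ((1 + σ ^ 2)⁻¹) ^ K * ‖((tL n ℏ)^[K] G) (x, s, p, σ)‖
          ≤ ((1 + σ ^ 2)⁻¹) ^ K * (C * ((2 ^ K * (1 + σ ^ 2) ^ K) * ((1 + |σ|) ^ 2)⁻¹)) := by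
            gcongr
            refine h1.trans (mul_le_mul_of_nonneg_left (h2.trans ?_) hC)
            gcongr
        _ = C * 2 ^ K * ((1 + |σ|) ^ 2)⁻¹ := by
            rw [inv_pow]
            have : (1 + σ ^ 2) ^ K ≠ 0 := by positivity
            field_simp

/-- Reordering of the iterated integrals. -/
lemma fubini_reorder {n : ℕ} {F : (Fin (n+1) → ℝ) × (ℝ × ((Fin (n+1) → ℝ) × ℝ)) → ℂ}
    (hF : Integrable F) :
    Integrable (fun xp : (Fin (n+1) → ℝ) × (Fin (n+1) → ℝ) =>
      ∫ σ : ℝ, ∫ s : ℝ, F (xp.1, s, xp.2, σ)) ∧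
    ∫ x, ∫ q, F (x, q) = ∫ xp : (Fin (n+1) → ℝ) × (Fin (n+1) → ℝ),
      ∫ σ : ℝ, ∫ s : ℝ, F (xp.1, s, xp.2, σ) := by
  let e1 : (Fin (n+1) → ℝ) × (ℝ × ((Fin (n+1) → ℝ) × ℝ)) ≃ᵐ
      (Fin (n+1) → ℝ) × (((Fin (n+1) → ℝ) × ℝ) × ℝ) :=
    (MeasurableEquiv.refl _).prodCongr MeasurableEquiv.prodComm
  let e2 : (Fin (n+1) → ℝ) × (((Fin (n+1) → ℝ) × ℝ) × ℝ) ≃ᵐ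
      (Fin (n+1) → ℝ) × ((Fin (n+1) → ℝ) × (ℝ × ℝ)) :=
    (MeasurableEquiv.refl _).prodCongr MeasurableEquiv.prodAssoc
  let e3 : (Fin (n+1) → ℝ) × ((Fin (n+1) → ℝ) × (ℝ × ℝ)) ≃ᵐ
      ((Fin (n+1) → ℝ) × (Fin (n+1) → ℝ)) × (ℝ × ℝ) := MeasurableEquiv.prodAssoc.symm
  have h1 : MeasurePreserving e1 := (MeasurePreserving.id _).prod Measure.measurePreserving_swap
  have h2 : MeasurePreserving e2 := (MeasurePreserving.id _).prod (measurePreserving_prodAssoc _ _ _)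
  have h3 : MeasurePreserving e3 :=
    (measurePreserving_prodAssoc volume volume volume).symm
  let e := (e1.trans (e2.trans e3)).symm
  have h : MeasurePreserving e := (h3.comp (h2.comp h1)).symm (e1.trans (e2.trans e3))
  have hFe : Integrable (fun w => F (e w)) :=
    (h.integrable_comp_emb e.measurableEmbedding).mpr hF
  have he : ∀ x p σ s, e ((x, p), (σ, s)) = (x, s, p, σ) := fun _ _ _ _ => rfl
  have hae : ∀ᵐ xp : (Fin (n+1) → ℝ) × (Fin (n+1) → ℝ),
      ∫ w : ℝ × ℝ, F (e (xp, w)) = ∫ σ : ℝ, ∫ s : ℝ, F (xp.1, s, xp.2, σ) := by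
    filter_upwards [hFe.prod_right_ae] with xp hxp
    exact integral_prod (fun w : ℝ × ℝ => F (e (xp, w))) hxp
  constructor
  · exact hFe.integral_prod_left.congr hae
  · have i1 : ∫ x, ∫ q, F (x, q) = ∫ v, F v := (integral_prod F hF).symm
    rw [i1, ← h.integral_comp e.measurableEmbedding F, ← integral_congr_ae hae]
    exact integral_prod _ hFe

lemma slice_bound {n k : ℕ}
    {H : (ℝ × (Fin (n+1) → ℝ) × (Fin (n+1) → ℝ) × (Fin (n+1) → ℝ)) → ℂ}
    (hH : ContDiff ℝ (⊤ : ℕ∞) H) {B : ℝ} (hB : ∀ w, ‖iteratedFDeriv ℝ k H w‖ ≤ B)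
    (x y p : Fin (n+1) → ℝ) (s : ℝ) :
    ‖iteratedDeriv k (fun s => H (s, x, y, p)) s‖ ≤ B := by
  let L : ℝ →L[ℝ] (ℝ × (Fin (n+1) → ℝ) × (Fin (n+1) → ℝ) × (Fin (n+1) → ℝ)) :=
    ContinuousLinearMap.inl ℝ ℝ _
  let c : (ℝ × (Fin (n+1) → ℝ) × (Fin (n+1) → ℝ) × (Fin (n+1) → ℝ)) := (0, x, y, p)
  have e : (fun s => H (s, x, y, p)) = (fun w => H (w + c)) ∘ L := by
    ext s
    simp [L, c]
  have hL : ‖L‖ ≤ 1 := ContinuousLinearMap.norm_inl_le_one ℝ ℝ _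
  rw [← norm_iteratedFDeriv_eq_norm_iteratedDeriv, e,
    L.iteratedFDeriv_comp_right (n := (⊤ : ℕ∞)) (f := fun w => H (w + c))
      (hH.comp (by fun_prop)) s (WithTop.coe_le_coe.mpr le_top), iteratedFDeriv_comp_add_right]
  refine (ContinuousMultilinearMap.norm_compContinuousLinearMap_le _ _).trans ?_
  have h1 : ∏ _i : Fin k, ‖L‖ ≤ 1 := Finset.prod_le_one (fun _ _ => norm_nonneg _) fun _ _ => hL
  calc _ ≤ ‖iteratedFDeriv ℝ k H (L s + c)‖ * 1 := by gcongr
    _ ≤ B := by rw [mul_one]; exact hB _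

lemma deriv_param_contDiff {W : Type*} [NormedAddCommGroup W] [NormedSpace ℝ W] {a : W → ℝ → ℂ}
    (hg : ContDiff ℝ (⊤ : ℕ∞) (fun q : W × ℝ => a q.1 q.2)) (σ : ℝ) :
    ContDiff ℝ (⊤ : ℕ∞) (fun w => deriv (a w) σ) := by
  have e : (fun w => deriv (a w) σ)
      = fun w => fderiv ℝ (fun q : W × ℝ => a q.1 q.2) (w, σ) (0, 1) := by
    ext s
    have h1 : HasFDerivAt (fun q : W × ℝ => a q.1 q.2) _ (s, σ) :=
      ((hg.differentiable (by simp)) (s, σ)).hasFDerivAt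
    have h2 : HasDerivAt (fun t : ℝ => (s, t)) ((0 : W), (1 : ℝ)) σ :=
      (hasDerivAt_const _ _).prodMk (hasDerivAt_id _)
    exact (h1.comp_hasDerivAt σ h2).deriv
  rw [e]
  have : ContDiff ℝ (⊤ : ℕ∞) (fderiv ℝ (fun q : W × ℝ => a q.1 q.2)) :=
    hg.fderiv_right (by simp)
  exact (this.comp (by fun_prop : ContDiff ℝ (⊤ : ℕ∞) (fun s : W => (s, σ)))).clm_apply
    contDiff_const

lemma symbCls_of_amplitude {n : ℕ} {m' R : ℝ}
    {a : (ℝ × (Fin (n+1) → ℝ) × (Fin (n+1) → ℝ) × (Fin (n+1) → ℝ)) → ℝ → ℂ}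
    (ha : IsAmplitude n m' a)
    (hR : ∀ s x y p σ, (R < ‖x‖ ∨ R < |s| ∨ R < ‖p‖) → a (s, x, y, p) σ = 0) :
    SymbCls n m' R (fun v => a (v.2.1, v.1, v.1, v.2.2.1) v.2.2.2) := by
  obtain ⟨hsm, -, hb⟩ := ha
  refine ⟨?_, fun x s p σ h => hR s x x p σ h, fun j => ?_⟩
  · exact hsm.comp (by fun_prop : ContDiff ℝ (⊤ : ℕ∞)
      (fun v : (Fin (n+1) → ℝ) × (ℝ × ((Fin (n+1) → ℝ) × ℝ)) =>
        ((v.2.1, v.1, v.1, v.2.2.1), v.2.2.2)))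
  · obtain ⟨C, hC⟩ := hb j 0
    simp only [iteratedDeriv_zero, Nat.cast_zero, sub_zero] at hC
    refine ⟨max C 0, le_max_right _ _, fun x s p σ => ?_⟩
    have hH : ContDiff ℝ (⊤ : ℕ∞) (fun w => a w σ) :=
      hsm.comp (by fun_prop : ContDiff ℝ (⊤ : ℕ∞)
        (fun w : ℝ × (Fin (n+1) → ℝ) × (Fin (n+1) → ℝ) × (Fin (n+1) → ℝ) => (w, σ)))
    refine (slice_bound hH (fun w => hC w σ) x x p s).trans ?_
    gcongr
    exact le_max_left _ _

lemma exists_dominating_one (R r : ℝ) (hr : -1 < r) : ∃ φ : ℝ → ℝ, Integrable φ ∧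
    (∀ t, 0 ≤ φ t) ∧ ∀ t ℏ : ℝ, t ≠ 0 → |t| ≤ R → 0 < ℏ → ℏ ≤ 1 → (ℏ + |t|) ^ r ≤ φ t := by
  rcases le_or_gt R 0 with hR | hR
  · refine ⟨fun _ => 0, integrable_zero _ _ _, fun _ => le_rfl, fun t ℏ ht h => ?_⟩
    exact absurd (abs_pos.mpr ht) (by linarith)
  let f : ℝ → ℝ := (Set.Ioc 0 R).indicator fun t => t ^ r
  have hf : Integrable f := by
    rw [integrable_indicator_iff measurableSet_Ioc]
    exact (intervalIntegrable_iff_integrableOn_Ioc_of_le hR.le).mp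
      (intervalIntegral.intervalIntegrable_rpow' hr)
  have hf0 : ∀ t, 0 ≤ f t := fun t =>
    Set.indicator_nonneg (fun t ht => rpow_nonneg ht.1.le r) t
  let b : ℝ → ℝ := (Set.Icc (-R) R).indicator fun t => (1 + |t|) ^ r
  have hb : Integrable b := by
    rw [integrable_indicator_iff measurableSet_Icc]
    refine ContinuousOn.integrableOn_compact isCompact_Icc ?_
    apply Continuous.continuousOn
    exact Continuous.rpow_const (by fun_prop) fun t => Or.inl (by positivity)
  have hb0 : ∀ t, 0 ≤ b t := fun t =>
    Set.indicator_nonneg (fun t ht => by positivity) t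
  refine ⟨fun t => b t + (f t + f (-t)), hb.add (hf.add hf.comp_neg),
    fun t => add_nonneg (hb0 t) (add_nonneg (hf0 t) (hf0 _)), ?_⟩
  intro t ℏ ht htR h0 h1
  rcases le_total 0 r with hr0 | hr0
  · have : b t = (1 + |t|) ^ r := Set.indicator_of_mem (Set.mem_Icc.mpr (abs_le.mp htR)) _
    have h2 : (ℏ + |t|) ^ r ≤ (1 + |t|) ^ r := rpow_le_rpow (by positivity) (by linarith) hr0
    linarith [hf0 t, hf0 (-t)]
  · have h2 : (ℏ + |t|) ^ r ≤ |t| ^ r :=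
      rpow_le_rpow_of_nonpos (abs_pos.mpr ht) (by linarith) hr0
    have h3 : |t| ^ r ≤ f t + f (-t) := by
      rcases lt_or_gt_of_ne ht with h | h
      · rw [abs_of_neg h] at htR ⊢
        have : f (-t) = (-t) ^ r := Set.indicator_of_mem (Set.mem_Ioc.mpr ⟨by linarith, htR⟩) _
        linarith [hf0 t]
      · rw [abs_of_pos h] at htR ⊢
        have : f t = t ^ r := Set.indicator_of_mem (Set.mem_Ioc.mpr ⟨h, htR⟩) _
        linarith [hf0 (-t)]
    linarith [hb0 t]

lemma exists_dominating (n : ℕ) (R r : ℝ) (hr : -1 < r) :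
    ∃ Φ : (Fin (n+1) → ℝ) → ℝ, Integrable Φ ∧ (∀ p, 0 ≤ Φ p) ∧
      ∀ p (ℏ : ℝ), p 0 ≠ 0 → ‖p‖ ≤ R → 0 < ℏ → ℏ ≤ 1 → (ℏ + |p 0|) ^ r ≤ Φ p := by
  obtain ⟨φ, hφ, hφ0, hφb⟩ := exists_dominating_one R r hr
  let c : ℝ → ℝ := (Set.Icc (-R) R).indicator fun _ => 1
  have hc : Integrable c := (integrable_indicator_iff measurableSet_Icc).mpr (by simp)
  have hc0 : ∀ t, 0 ≤ c t := fun t => Set.indicator_nonneg (fun _ _ => zero_le_one) t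
  refine ⟨fun p => ∏ i, (if i = 0 then φ else c) (p i), ?_, ?_, ?_⟩
  · exact Integrable.fintype_prod (μ := fun _ => volume)
      (f := fun i : Fin (n+1) => if i = 0 then φ else c) (fun i => by split_ifs <;> assumption)
  · intro p
    refine Finset.prod_nonneg fun i _ => ?_
    split_ifs
    · exact hφ0 _
    · exact hc0 _
  · intro p ℏ hp hpR h0 h1
    have hpi : ∀ i, |p i| ≤ R := fun i => (norm_le_pi_norm p i).trans hpR
    simp only
    rw [Fin.prod_univ_succ]
    have : ∏ i : Fin n, (if i.succ = 0 then φ else c) (p i.succ) = 1 := by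
      refine Finset.prod_eq_one fun i _ => ?_
      rw [if_neg (Fin.succ_ne_zero i)]
      exact Set.indicator_of_mem (Set.mem_Icc.mpr (abs_le.mp (hpi _))) _
    rw [this, mul_one, if_pos rfl]
    exact hφb _ _ hp (hpi 0) h0 h1

/-- The inner integrals reduce to the unregularized one. -/
lemma inner_eq {R : ℝ} {f : ℝ → ℂ} (hf : ContDiff ℝ (⊤ : ℕ∞) f)
    (h0 : ∀ s, R < |s| → f s = 0) (ℏ t σ : ℝ) (K : ℕ) :
    ∫ s : ℝ, Complex.exp (Complex.I * (s * σ : ℝ)) *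
      (Complex.ofReal (1 + σ ^ 2))⁻¹ ^ K *
      (oneAddDsq^[K] (fun s : ℝ =>
        Complex.exp (-Complex.I * Complex.ofReal (ℏ⁻¹ * s * t)) * f s)) s
      = FT f (σ - ℏ⁻¹ * t) := by
  have hE : ContDiff ℝ (⊤ : ℕ∞)
      (fun s : ℝ => Complex.exp (-Complex.I * Complex.ofReal (ℏ⁻¹ * s * t)) * f s) := by
    refine ContDiff.mul (ContDiff.cexp (contDiff_const.mul ?_)) hf
    exact Complex.ofRealCLM.contDiff.comp
      (by fun_prop : ContDiff ℝ (⊤ : ℕ∞) (fun s : ℝ => ℏ⁻¹ * s * t))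
  have h := FT_oneAddDsq_iterate K hE
    (cs_of_zero (R := R) (fun s hs => by simp only [h0 s hs, mul_zero])) σ
  have h1 : ∀ s : ℝ, Complex.exp (Complex.I * (s * σ : ℝ)) *
      (Complex.ofReal (1 + σ ^ 2))⁻¹ ^ K *
      (oneAddDsq^[K] (fun s : ℝ =>
        Complex.exp (-Complex.I * Complex.ofReal (ℏ⁻¹ * s * t)) * f s)) s
      = (Complex.ofReal (1 + σ ^ 2))⁻¹ ^ K * (Complex.exp (Complex.I * (s * σ : ℝ)) *
      (oneAddDsq^[K] (fun s : ℝ =>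
        Complex.exp (-Complex.I * Complex.ofReal (ℏ⁻¹ * s * t)) * f s)) s) := fun s => by ring
  simp_rw [h1]
  rw [integral_const_mul]
  have h2 := h
  unfold FT at h2
  rw [h2, ← mul_assoc, ← mul_pow, inv_mul_cancel₀, one_pow, one_mul]
  · unfold FT
    congr 1
    ext s
    rw [← mul_assoc, ← Complex.exp_add]
    congr 2
    push_cast
    ring
  · have : (1 + σ ^ 2 : ℝ) ≠ 0 := by positivity
    exact_mod_cast this

/-- trace asymptotics with homogeneous leading term, `m' > 0`:
as `ℏ → 0⁺`,
`∫ u_ℏ(x,x) dx = (2π)^{1-(n+1)} ℏ^{-(n+1)-m'} ∫ |p₁|^{m'}(ã₊ 𝟙_{p₁>0} + ã₋ 𝟙_{p₁<0}) dx dp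
 + O(ℏ^{-(n+1)-m'+1})`. -/
theorem statement5 (n : ℕ) (m' : ℝ)
    (a : (ℝ × (Fin (n+1) → ℝ) × (Fin (n+1) → ℝ) × (Fin (n+1) → ℝ)) → ℝ → ℂ)
    (ha : IsAmplitude n m' a) (hm : 0 < m')
    (aP aM : (Fin (n+1) → ℝ) × (Fin (n+1) → ℝ) → ℂ)
    (haPc : Continuous aP) (haPs : HasCompactSupport aP)
    (haMc : Continuous aM) (haMs : HasCompactSupport aM)
    (C : ℝ) (hC : 0 < C)
    (hplus : ∀ (x p : Fin (n+1) → ℝ) (σ : ℝ), 0 < σ →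
      ‖a (0, x, x, p) σ - Complex.ofReal (σ ^ m') * aP (x, p)‖ ≤ C * (1 + σ) ^ (m' - 1))
    (hminus : ∀ (x p : Fin (n+1) → ℝ) (σ : ℝ), σ < 0 →
      ‖a (0, x, x, p) σ - Complex.ofReal (|σ| ^ m') * aM (x, p)‖ ≤ C * (1 + |σ|) ^ (m' - 1)) :
    ∃ C' > (0 : ℝ), ∃ ℏ₀ > (0 : ℝ), ∀ ℏ : ℝ, 0 < ℏ → ℏ ≤ ℏ₀ →
      ‖(∫ x : Fin (n+1) → ℝ, uh n m' a ℏ x x) -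
          Complex.ofReal ((2 * π) ^ (1 - ((n : ℝ) + 1)) * ℏ ^ (-((n : ℝ) + 1) - m')) *
            ∫ xp : (Fin (n+1) → ℝ) × (Fin (n+1) → ℝ),
              Complex.ofReal (|xp.2 0| ^ m') *
                (if 0 < xp.2 0 then aP xp else if xp.2 0 < 0 then aM xp else 0)‖
        ≤ C' * ℏ ^ (-((n : ℝ) + 1) - m' + 1) := by
  have ha' := ha
  obtain ⟨hsm, ⟨K, hK, hK0⟩, hb⟩ := ha'
  obtain ⟨R1, hR1⟩ := hK.isBounded.subset_closedBall 0
  obtain ⟨R2, hR2⟩ := haPs.isCompact.isBounded.subset_closedBall 0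
  obtain ⟨R3, hR3⟩ := haMs.isCompact.isBounded.subset_closedBall 0
  obtain ⟨R, hR0, hRR1, hRR2, hRR3⟩ : ∃ R : ℝ, 0 ≤ R ∧ R1 ≤ R ∧ R2 ≤ R ∧ R3 ≤ R :=
    ⟨max (max R1 R2) (max R3 0), by simp, by simp, by simp, by simp⟩
  have hsupp : ∀ s x y p σ, (R < ‖x‖ ∨ R < |s| ∨ R < ‖p‖) → a (s, x, y, p) σ = 0 := by
    intro s x y p σ h
    apply hK0
    intro hmem
    have := hR1 hmem
    rw [mem_closedBall_zero_iff] at this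
    have h1 : ‖s‖ ≤ R1 := (norm_fst_le (s, x, y, p)).trans this
    have h2 := (norm_snd_le (s, x, y, p)).trans this
    have h3 : ‖x‖ ≤ R1 := (norm_fst_le (x, y, p)).trans h2
    have h4 : ‖p‖ ≤ R1 := ((norm_snd_le (y, p)).trans (norm_snd_le (x, y, p))).trans h2
    rw [Real.norm_eq_abs] at h1
    rcases h with h | h | h <;> linarith
  have hsuppT : ∀ (b : (Fin (n+1) → ℝ) × (Fin (n+1) → ℝ) → ℂ) (R' : ℝ), R' ≤ R →
      tsupport b ⊆ Metric.closedBall 0 R' → ∀ x p, (R < ‖x‖ ∨ R < ‖p‖) → b (x, p) = 0 := by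
    intro b R' hR' hb x p h
    by_contra hne
    have := hb (subset_tsupport b hne)
    rw [mem_closedBall_zero_iff] at this
    have h1 : ‖x‖ ≤ R' := (norm_fst_le (x, p)).trans this
    have h2 : ‖p‖ ≤ R' := (norm_snd_le (x, p)).trans this
    rcases h with h | h <;> linarith
  have hG := symbCls_of_amplitude ha hsupp
  -- constants
  obtain ⟨A1, hA1⟩ := hb 0 1
  obtain ⟨A2, hA2⟩ := hb (⌈|m' - 1|⌉₊ + 3) 1
  simp only [iteratedDeriv_one, Nat.cast_one] at hA1 hA2
  obtain ⟨A, hA0, hAA1, hAA2⟩ : ∃ A : ℝ, 0 ≤ A ∧ A1 ≤ A ∧ A2 ≤ A :=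
    ⟨max (max A1 A2) 0, by simp, by simp, by simp⟩
  obtain ⟨C1, hC1, hcore⟩ := core m' R A hR0 hA0
  obtain ⟨Φ, hΦ, hΦ0, hΦb⟩ := exists_dominating n R (m' - 1) (by linarith)
  -- the limiting symbol
  set lead : (Fin (n+1) → ℝ) × (Fin (n+1) → ℝ) → ℂ := fun xp =>
    Complex.ofReal (|xp.2 0| ^ m') *
      (if 0 < xp.2 0 then aP xp else if xp.2 0 < 0 then aM xp else 0) with hlead
  have hleadint : Integrable lead := by
    have hcm : Continuous (fun xp : (Fin (n+1) → ℝ) × (Fin (n+1) → ℝ) => |xp.2 0| ^ m') :=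
      Continuous.rpow_const (by fun_prop) fun _ => Or.inr hm.le
    have hi : Integrable (fun xp : (Fin (n+1) → ℝ) × (Fin (n+1) → ℝ) =>
        |xp.2 0| ^ m' * (‖aP xp‖ + ‖aM xp‖)) := by
      refine Continuous.integrable_of_hasCompactSupport
        (hcm.mul (haPc.norm.add haMc.norm)) ?_
      exact (haPs.norm.add haMs.norm).mul_left
    refine hi.mono' ?_ (Filter.Eventually.of_forall fun xp => ?_)
    · have hmeas : Measurable (fun xp : (Fin (n+1) → ℝ) × (Fin (n+1) → ℝ) => xp.2 0) := by
        fun_prop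
      refine Measurable.aestronglyMeasurable ?_
      refine (Complex.continuous_ofReal.comp hcm).measurable.mul ?_
      refine Measurable.ite (measurableSet_lt measurable_const hmeas) haPc.measurable ?_
      exact Measurable.ite (measurableSet_lt hmeas measurable_const) haMc.measurable
        measurable_const
    · simp only [hlead]
      rw [norm_mul, Complex.norm_real, Real.norm_of_nonneg (by positivity)]
      gcongr
      have := norm_nonneg (aP xp)
      have := norm_nonneg (aM xp)
      split_ifs
      · linarith
      · linarith
      · simp only [norm_zero]; linarith
  set D : ℝ := C1 + 2 * π * C with hD
  have hD0 : 0 ≤ D := by positivity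
  set ind : (Fin (n+1) → ℝ) → ℝ :=
    (Metric.closedBall (0 : Fin (n+1) → ℝ) R).indicator fun _ => (1 : ℝ) with hind
  have hX : Integrable ind :=
    (integrable_indicator_iff Metric.isClosed_closedBall.measurableSet).mpr
      (integrableOn_const (isCompact_closedBall _ _).measure_lt_top.ne)
  have hind0 : ∀ x, 0 ≤ ind x := fun x => Set.indicator_nonneg (fun _ _ => zero_le_one) x
  have hdom : Integrable (fun xp : (Fin (n+1) → ℝ) × (Fin (n+1) → ℝ) => ind xp.1 * Φ xp.2) :=
    hX.mul_prod hΦ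
  set I0 : ℝ := ∫ xp : (Fin (n+1) → ℝ) × (Fin (n+1) → ℝ), ind xp.1 * Φ xp.2 with hI0
  have hI00 : 0 ≤ I0 := integral_nonneg fun xp => mul_nonneg (hind0 _) (hΦ0 _)
  refine ⟨(2 * π) ^ (-((n : ℝ) + 1)) * (D * I0) + 1, by positivity, 1, one_pos, ?_⟩
  intro ℏ hℏ hℏ1
  set k : ℕ := ⌈m' / 2 + 1⌉₊ with hk
  have hFint := integrand_integrable hR0 ℏ k (Nat.le_ceil _) hG
  obtain ⟨hJint, hJ⟩ := fubini_reorder hFint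
  set J : (Fin (n+1) → ℝ) × (Fin (n+1) → ℝ) → ℂ := fun xp =>
    ∫ σ : ℝ, FT (fun s => a (s, xp.1, xp.1, xp.2) σ) (σ - ℏ⁻¹ * xp.2 0) with hJdef
  have hslice : ∀ x p σ, ContDiff ℝ (⊤ : ℕ∞) (fun s => a (s, x, x, p) σ) := fun x p σ =>
    hsm.comp (by fun_prop : ContDiff ℝ (⊤ : ℕ∞) (fun s : ℝ => ((s, x, x, p), σ)))
  have hJeq : ∀ xp : (Fin (n+1) → ℝ) × (Fin (n+1) → ℝ), (∫ σ : ℝ, ∫ s : ℝ,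
      Complex.exp (Complex.I * (s * σ : ℝ)) *
      (Complex.ofReal (1 + σ ^ 2))⁻¹ ^ k *
      (oneAddDsq^[k] (fun s : ℝ =>
        Complex.exp (-Complex.I * Complex.ofReal (ℏ⁻¹ * s * xp.2 0)) *
          a (s, xp.1, xp.1, xp.2) σ)) s) = J xp := by
    intro xp
    simp only [hJdef]
    congr 1
    ext σ
    exact inner_eq (hslice _ _ _) (fun s hs => hsupp s _ _ _ _ (Or.inr (Or.inl hs))) ℏ _ σ k
  simp only [hJeq] at hJint hJ
  -- the trace as an integral of `J`
  have htrace : ∫ x : Fin (n+1) → ℝ, uh n m' a ℏ x x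
      = Complex.ofReal ((2 * π * ℏ) ^ (-((n : ℤ) + 1))) * ∫ xp, J xp := by
    unfold uh
    rw [integral_const_mul, ← hJ]
    congr 2
    ext x
    congr 1
    ext q
    simp [oscIntegrand, ← hk]
  -- pointwise estimate
  have hscale : ∀ t : ℝ, (1 + |ℏ⁻¹ * t|) ^ (m' - 1) = ℏ ^ (1 - m') * (ℏ + |t|) ^ (m' - 1) := by
    intro t
    have : 1 + |ℏ⁻¹ * t| = ℏ⁻¹ * (ℏ + |t|) := by
      rw [abs_mul, abs_of_pos (inv_pos.mpr hℏ)]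
      field_simp
    rw [this, mul_rpow (by positivity) (by positivity), inv_rpow hℏ.le, ← rpow_neg hℏ.le, neg_sub]
  have hscale2 : ∀ t : ℝ, |ℏ⁻¹ * t| ^ m' = ℏ ^ (-m') * |t| ^ m' := by
    intro t
    rw [abs_mul, abs_of_pos (inv_pos.mpr hℏ), mul_rpow (by positivity) (by positivity),
      inv_rpow hℏ.le, ← rpow_neg hℏ.le]
  have hpt : ∀ xp : (Fin (n+1) → ℝ) × (Fin (n+1) → ℝ), xp.2 0 ≠ 0 →
      ‖J xp - Complex.ofReal (2 * π * ℏ ^ (-m')) * lead xp‖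
        ≤ (D * ℏ ^ (1 - m')) * (ind xp.1 * Φ xp.2) := by
    rintro ⟨x, p⟩ hp
    simp only at hp ⊢
    by_cases hbox : R < ‖x‖ ∨ R < ‖p‖
    · have hJ0 : J (x, p) = 0 := by
        simp only [hJdef]
        have : ∀ s σ, a (s, x, x, p) σ = 0 := fun s σ => hsupp s x x p σ (by tauto)
        simp [this, FT]
      have hl0 : lead (x, p) = 0 := by
        simp only [hlead]
        rw [hsuppT aP R2 hRR2 hR2 x p hbox, hsuppT aM R3 hRR3 hR3 x p hbox]
        simp
      rw [hJ0, hl0, mul_zero, sub_zero, norm_zero]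
      have := hind0 x
      have := hΦ0 p
      positivity
    push Not at hbox
    have hi1 : ind x = 1 := Set.indicator_of_mem (by simpa using hbox.1) _
    rw [hi1, one_mul]
    set l : ℝ := ℏ⁻¹ * p 0 with hl
    have hc := hcore (fun s σ => a (s, x, x, p) σ)
      (hsm.comp (by fun_prop : ContDiff ℝ (⊤ : ℕ∞) (fun q : ℝ × ℝ => ((q.1, x, x, p), q.2))))
      (fun s σ hs => hsupp s x x p σ (Or.inr (Or.inl hs)))
      (fun s σ => by
        have h := hA1 (s, x, x, p) σ
        rw [norm_iteratedFDeriv_zero] at h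
        refine h.trans ?_
        gcongr)
      (fun s σ => by
        refine (slice_bound (deriv_param_contDiff hsm σ) (fun w => hA2 w σ) x x p s).trans ?_
        gcongr)
      l
    have hld : ‖a (0, x, x, p) l - Complex.ofReal (ℏ ^ (-m')) * lead (x, p)‖
        ≤ C * (1 + |l|) ^ (m' - 1) := by
      simp only [hlead]
      rw [← mul_assoc, ← Complex.ofReal_mul, ← hscale2, ← hl]
      rcases lt_or_gt_of_ne hp with h | h
      · have hl' : l < 0 := mul_neg_of_pos_of_neg (inv_pos.mpr hℏ) h
        rw [if_neg (not_lt.mpr h.le), if_pos h]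
        exact hminus x p l hl'
      · have hl' : 0 < l := mul_pos (inv_pos.mpr hℏ) h
        rw [if_pos h]
        have := hplus x p l hl'
        rwa [abs_of_pos hl']
    have hsplit : J (x, p) - Complex.ofReal (2 * π * ℏ ^ (-m')) * lead (x, p)
        = (J (x, p) - 2 * π * a (0, x, x, p) l)
          + (2 * π) * (a (0, x, x, p) l - Complex.ofReal (ℏ ^ (-m')) * lead (x, p)) := by
      push_cast
      ring
    rw [hsplit]
    have h2pi : ‖(2 * π : ℂ)‖ = 2 * π := by
      rw [norm_mul, Complex.norm_real, Real.norm_of_nonneg pi_pos.le]; simp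
    calc _ ≤ C1 * (1 + |l|) ^ (m' - 1) + 2 * π * (C * (1 + |l|) ^ (m' - 1)) := by
          refine (norm_add_le _ _).trans (add_le_add hc ?_)
          rw [norm_mul, h2pi]
          gcongr
      _ = D * (1 + |l|) ^ (m' - 1) := by rw [hD]; ring
      _ = (D * ℏ ^ (1 - m')) * (ℏ + |p 0|) ^ (m' - 1) := by rw [hl, hscale]; ring
      _ ≤ _ := by
          gcongr
          exact hΦb p ℏ hp hbox.2 hℏ hℏ1
  have hae : ∀ᵐ xp : (Fin (n+1) → ℝ) × (Fin (n+1) → ℝ), xp.2 0 ≠ 0 := by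
    have h1 : ∀ᵐ p : Fin (n+1) → ℝ, p 0 ≠ 0 := by
      rw [ae_iff]
      simp only [not_not]
      exact Measure.pi_hyperplane (fun _ => volume) 0 0
    exact Measure.quasiMeasurePreserving_snd.ae h1
  have hest : ‖(∫ xp, J xp) - Complex.ofReal (2 * π * ℏ ^ (-m')) * ∫ xp, lead xp‖
      ≤ D * ℏ ^ (1 - m') * I0 := by
    rw [← integral_const_mul, ← integral_sub hJint (hleadint.const_mul _), hI0,
      ← integral_const_mul]
    exact norm_integral_le_of_norm_le (hdom.const_mul _) (hae.mono hpt)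
  -- conclusion
  have hc1 : (2 * π * ℏ) ^ (-((n : ℤ) + 1))
      = (2 * π) ^ (-((n : ℝ) + 1)) * ℏ ^ (-((n : ℝ) + 1)) := by
    rw [← mul_rpow (by positivity) hℏ.le, ← rpow_intCast]
    push_cast
    rfl
  have hc2 : (2 * π) ^ (1 - ((n : ℝ) + 1)) * ℏ ^ (-((n : ℝ) + 1) - m')
      = (2 * π * ℏ) ^ (-((n : ℤ) + 1)) * (2 * π * ℏ ^ (-m')) := by
    rw [hc1, sub_eq_add_neg 1, rpow_add (by positivity), rpow_one, sub_eq_add_neg _ m',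
      rpow_add hℏ]
    ring
  rw [htrace, hc2, Complex.ofReal_mul,
    mul_assoc (Complex.ofReal ((2 * π * ℏ) ^ (-((n : ℤ) + 1)))), ← mul_sub, norm_mul, Complex.norm_real,
    Real.norm_of_nonneg (by positivity)]
  calc (2 * π * ℏ) ^ (-((n : ℤ) + 1)) *
        ‖(∫ xp, J xp) - Complex.ofReal (2 * π * ℏ ^ (-m')) * ∫ xp, lead xp‖
      ≤ (2 * π * ℏ) ^ (-((n : ℤ) + 1)) * (D * ℏ ^ (1 - m') * I0) := by gcongr
    _ = (2 * π) ^ (-((n : ℝ) + 1)) * (D * I0) * ℏ ^ (-((n : ℝ) + 1) - m' + 1) := by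
      have : -((n : ℝ) + 1) - m' + 1 = -((n : ℝ) + 1) + (1 - m') := by ring
      rw [hc1, this, rpow_add hℏ]
      ring
    _ ≤ _ := by
      gcongr
      linarith
end
end

section
/- Let a be an amplitude of order m′ = 0, and suppose a has a homogeneous leading term at s = 0, y = x: there exist continuous compactly supported functions ã₊, ã₋ : ℝ^n × ℝ^n → ℂ and a constant C > 0 such that |a(0,x,x,p,σ) − ã₊(x,p)| ≤ C(1+σ)^{−1} for all σ > 0 and |a(0,x,x,p,σ) − ã₋(x,p)| ≤ C(1+|σ|)^{−1} for all σ < 0, for all (x,p). Then, as ħ → 0⁺, ∫_{ℝ^n} u_ħ(x,x) dx = (2π)^{1−n} ħ^{−n} ∫_{ℝ^n × ℝ^n} ( ã₊(x,p)·𝟙_{p₁>0} + ã₋(x,p)·𝟙_{p₁<0} ) dx dp + O(ħ^{−n+1} log(1/ħ)); that is, there are constants C′ > 0 and ħ₀ ∈ (0,1) such that for all 0 < ħ ≤ ħ₀ the absolute value of the difference of the two sides is at most C′ ħ^{−n+1} log(1/ħ). -/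
open MeasureTheory Real

noncomputable section

open scoped FourierTransform ContDiff

/-- one-dimensional version of the amplitude hypotheses -/
def Good (R M : ℝ) (b : ℝ → ℝ → ℂ) : Prop :=
  ContDiff ℝ ∞ (fun q : ℝ × ℝ => b q.1 q.2) ∧
  (∀ s σ, R < |s| → b s σ = 0) ∧
  (∀ k ≤ 4, ∀ s σ, ‖iteratedDeriv k (fun s => b s σ) s‖ ≤ M) ∧
  (∀ k ≤ 4, ∀ s σ, ‖iteratedDeriv k (fun s => deriv (b s) σ) s‖ ≤ M / (1 + |σ|))

lemma supp_iter (g : ℝ → ℂ) (R : ℝ) (hs : ∀ s, R < |s| → g s = 0) (k : ℕ) :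
    ∀ s, R < |s| → iteratedDeriv k g s = 0 := by
  intro s hsR
  by_contra h
  have h1 : s ∈ Function.support (iteratedFDeriv ℝ k g) := by
    intro h0
    apply h
    rw [iteratedDeriv_eq_iteratedFDeriv, h0]; simp
  have h2 := support_iteratedFDeriv_subset k h1
  have h3 : tsupport g ⊆ {s | |s| ≤ R} := by
    apply closure_minimal
    · intro t ht
      by_contra hc
      exact ht (hs t (not_le.mp hc))
    · exact isClosed_le continuous_abs continuous_const
  exact absurd (h3 h2) (not_le.mpr hsR)

lemma supp_integrable (g : ℝ → ℂ) (hg : Continuous g) (R : ℝ) (hs : ∀ s, R < |s| → g s = 0) :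
    Integrable g := by
  apply hg.integrable_of_hasCompactSupport
  apply HasCompactSupport.intro (isCompact_Icc (a := -R) (b := R))
  intro s h
  apply hs
  by_contra hc
  exact h (abs_le.mp (not_lt.mp hc))

lemma supp_integral_le (g : ℝ → ℂ) (R M : ℝ) (hR : 0 < R)
    (hs : ∀ s, R < |s| → g s = 0) (hM : ∀ s, ‖g s‖ ≤ M) : ∫ s, ‖g s‖ ≤ 2 * R * M := by
  have h : ∀ s, ‖g s‖ ≤ (Set.Icc (-R) R).indicator (fun _ => M) s := by
    intro s
    by_cases h : s ∈ Set.Icc (-R) R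
    · rw [Set.indicator_of_mem h]; exact hM s
    · rw [Set.indicator_of_notMem h, hs s, norm_zero]
      by_contra hc
      exact h (abs_le.mp (not_lt.mp hc))
  calc ∫ s, ‖g s‖ ≤ ∫ s, (Set.Icc (-R) R).indicator (fun _ => M) s := by
        apply integral_mono_of_nonneg
        · exact Filter.Eventually.of_forall fun s => norm_nonneg _
        · rw [integrable_indicator_iff measurableSet_Icc]
          exact integrableOn_const (by simp)
        · exact Filter.Eventually.of_forall h
    _ = 2 * R * M := by
        rw [integral_indicator measurableSet_Icc, setIntegral_const]
        simp [Measure.real]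
        left
        rw [ENNReal.toReal_ofReal (by linarith)]; ring

lemma fourier_norm_le (g : ℝ → ℂ) (R M : ℝ) (hR : 0 < R)
    (hs : ∀ s, R < |s| → g s = 0) (hM : ∀ s, ‖g s‖ ≤ M) (ξ : ℝ) : ‖𝓕 g ξ‖ ≤ 2 * R * M := by
  refine le_trans ?_ (supp_integral_le g R M hR hs hM)
  rw [Real.fourier_real_eq_integral_exp_smul]
  refine (norm_integral_le_integral_norm _).trans (le_of_eq ?_)
  congr 1; ext s
  rw [norm_smul, Complex.norm_exp_ofReal_mul_I, one_mul]

lemma fourier_iter (g : ℝ → ℂ) (hg : ContDiff ℝ ∞ g) (R : ℝ)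
    (hs : ∀ s, R < |s| → g s = 0) (k : ℕ) (ξ : ℝ) :
    𝓕 (iteratedDeriv k g) ξ = (2 * π * Complex.I * ξ) ^ k • 𝓕 g ξ := by
  have := Real.fourier_iteratedDeriv (f := g) (N := ⊤) (n := k) (by exact hg) ?_ (by simp)
  · rw [this]
  · intro j _
    exact supp_integrable _ (hg.continuous_iteratedDeriv j (by exact_mod_cast le_top)) R
      (supp_iter g R hs j)

lemma fourier_decay (g : ℝ → ℂ) (hg : ContDiff ℝ ∞ g) (R M : ℝ) (hR : 0 < R)
    (hs : ∀ s, R < |s| → g s = 0) (hM : ∀ s, ‖g s‖ ≤ M)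
    (hM4 : ∀ s, ‖iteratedDeriv 4 g s‖ ≤ M) (ξ : ℝ) :
    ‖𝓕 g ξ‖ ≤ 4 * R * M / (1 + (2 * π * ξ) ^ 4) := by
  have h0 := fourier_norm_le g R M hR hs hM ξ
  have h4 := fourier_norm_le _ R M hR (supp_iter g R hs 4) hM4 ξ
  rw [fourier_iter g hg R hs, norm_smul] at h4
  have : ‖(2 * (π : ℂ) * Complex.I * ξ) ^ 4‖ = (2 * π * ξ) ^ 4 := by
    rw [norm_pow]
    simp only [norm_mul, Complex.norm_I, Complex.norm_real, mul_one, norm_eq_abs, Complex.norm_ofNat]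
    rw [abs_of_pos pi_pos, mul_pow, mul_pow (2 * π), Even.pow_abs (by decide)]
  rw [this] at h4
  rw [le_div_iff₀ (by positivity)]
  nlinarith

lemma good_slice {R M : ℝ} {b : ℝ → ℝ → ℂ} (hb : Good R M b) (σ : ℝ) :
    ContDiff ℝ ∞ (fun s => b s σ) :=
  hb.1.comp (contDiff_id.prodMk contDiff_const)

lemma good_dslice {R M : ℝ} {b : ℝ → ℝ → ℂ} (hb : Good R M b) (s σ : ℝ) :
    HasDerivAt (b s) (fderiv ℝ (fun q : ℝ × ℝ => b q.1 q.2) (s, σ) (0, 1)) σ := by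
  have h1 : HasFDerivAt (fun q : ℝ × ℝ => b q.1 q.2) (fderiv ℝ (fun q : ℝ × ℝ => b q.1 q.2) (s, σ)) (s, σ) :=
    (hb.1.differentiable (by simp) _).hasFDerivAt
  have h2 : HasDerivAt (fun σ : ℝ => (s, σ)) ((0 : ℝ), (1 : ℝ)) σ :=
    (hasDerivAt_const σ s).prodMk (hasDerivAt_id σ)
  exact h1.comp_hasDerivAt σ h2

lemma good_dcont {R M : ℝ} {b : ℝ → ℝ → ℂ} (hb : Good R M b) :
    ContDiff ℝ ∞ (fun q : ℝ × ℝ => deriv (b q.1) q.2) := by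
  have : (fun q : ℝ × ℝ => deriv (b q.1) q.2) =
    fun q => fderiv ℝ (fun q : ℝ × ℝ => b q.1 q.2) q (0, 1) := by
    ext q; exact (good_dslice hb q.1 q.2).deriv
  rw [this]
  exact (hb.1.fderiv_right (m := ∞) (by simp)).clm_apply contDiff_const

lemma good_dsupp {R M : ℝ} {b : ℝ → ℝ → ℂ} (hb : Good R M b) (s σ : ℝ) (h : R < |s|) :
    deriv (b s) σ = 0 := by
  have : b s = fun _ => 0 := by ext σ; exact hb.2.1 s σ h
  rw [this]; simp

lemma good_M {R M : ℝ} {b : ℝ → ℝ → ℂ} (hb : Good R M b) : 0 ≤ M :=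
  (norm_nonneg _).trans (hb.2.2.1 0 (by simp) 0 0)

lemma phi_decay {R M : ℝ} (hR : 0 < R) {b : ℝ → ℝ → ℂ} (hb : Good R M b) (σ ξ : ℝ) :
    ‖𝓕 (fun s => b s σ) ξ‖ ≤ 4 * R * M / (1 + (2 * π * ξ) ^ 4) :=
  fourier_decay _ (good_slice hb σ) R M hR (fun s h => hb.2.1 s σ h)
    (fun s => by simpa using hb.2.2.1 0 (by simp) s σ) (fun s => hb.2.2.1 4 le_rfl s σ) ξ

lemma dphi_decay {R M : ℝ} (hR : 0 < R) {b : ℝ → ℝ → ℂ} (hb : Good R M b) (σ ξ : ℝ) :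
    ‖𝓕 (fun s => deriv (b s) σ) ξ‖ ≤ 4 * R * (M / (1 + |σ|)) / (1 + (2 * π * ξ) ^ 4) :=
  fourier_decay _ ((good_dcont hb).comp (contDiff_id.prodMk contDiff_const)) R _ hR
    (fun s h => good_dsupp hb s σ h)
    (fun s => by simpa using hb.2.2.2 0 (by simp) s σ) (fun s => hb.2.2.2 4 le_rfl s σ) ξ

lemma phi_deriv {R M : ℝ} {b : ℝ → ℝ → ℂ} (hb : Good R M b) (σ ξ : ℝ) :
    HasDerivAt (fun σ => 𝓕 (fun s => b s σ) ξ) (𝓕 (fun s => deriv (b s) σ) ξ) σ := by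
  simp only [Real.fourier_real_eq_integral_exp_smul]
  have hM := good_M hb
  refine (hasDerivAt_integral_of_dominated_loc_of_deriv_le (𝕜 := ℝ) (s := Set.univ)
    (F := fun σ s => Complex.exp (↑(-2 * π * s * ξ) * Complex.I) • b s σ)
    (F' := fun σ s => Complex.exp (↑(-2 * π * s * ξ) * Complex.I) • deriv (b s) σ)
    (bound := (Set.Icc (-R) R).indicator (fun _ => M)) Filter.univ_mem
    ?_ ?_ ?_ ?_ ?_ ?_).2
  · refine Filter.Eventually.of_forall fun σ => ?_
    have := (good_slice hb σ).continuous
    exact Continuous.aestronglyMeasurable (by fun_prop)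
  · have := (good_slice hb σ).continuous
    apply supp_integrable _ (by fun_prop) R
    intro s h
    simp [hb.2.1 s σ h]
  · have : Continuous fun s => deriv (b s) σ :=
      ((good_dcont hb).comp (contDiff_id.prodMk contDiff_const)).continuous
    exact Continuous.aestronglyMeasurable (by fun_prop)
  · refine Filter.Eventually.of_forall fun s σ _ => ?_
    rw [norm_smul, Complex.norm_exp_ofReal_mul_I, one_mul]
    by_cases h : s ∈ Set.Icc (-R) R
    · rw [Set.indicator_of_mem h]
      have := hb.2.2.2 0 (by simp) s σ
      simp only [iteratedDeriv_zero] at this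
      refine this.trans (div_le_self hM ?_)
      linarith [abs_nonneg σ]
    · rw [Set.indicator_of_notMem h, good_dsupp hb s, norm_zero]
      by_contra hc
      exact h (abs_le.mp (not_lt.mp hc))
  · rw [integrable_indicator_iff measurableSet_Icc]
    exact integrableOn_const (by simp)
  · refine Filter.Eventually.of_forall fun s σ _ => ?_
    have := (good_dslice hb s σ)
    exact (this.differentiableAt.hasDerivAt).const_smul
      (Complex.exp (↑(-2 * π * s * ξ) * Complex.I))

lemma peetre_s6 (σ t : ℝ) : (1 + |σ + t|)⁻¹ ≤ (1 + |t|) / (1 + |σ|) := by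
  have h1 := abs_nonneg σ
  have h2 := abs_nonneg t
  have h3 := abs_nonneg (σ + t)
  rw [le_div_iff₀ (by positivity), inv_mul_le_iff₀ (by positivity)]
  have : |σ| ≤ |σ + t| + |t| := by
    calc |σ| = |(σ + t) - t| := by ring_nf
      _ ≤ _ := abs_sub _ _
  nlinarith

lemma phi_diff {R M : ℝ} (hR : 0 < R) {b : ℝ → ℝ → ℂ} (hb : Good R M b) (l t ξ : ℝ)
    (ht : |t| ≤ |2 * π * ξ|) :
    ‖𝓕 (fun s => b s (l + t)) ξ - 𝓕 (fun s => b s l) ξ‖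
      ≤ 16 * R * M / (1 + |l|) * (1 + (2 * π * ξ) ^ 2)⁻¹ := by
  have hM := good_M hb
  set τ := |2 * π * ξ| with hτ
  have hτ0 : 0 ≤ τ := abs_nonneg _
  have e4 : (2 * π * ξ) ^ 4 = τ ^ 4 := by rw [hτ, Even.pow_abs (by decide)]
  have e2 : (2 * π * ξ) ^ 2 = τ ^ 2 := by rw [hτ, sq_abs]
  have hl : 0 < 1 + |l| := by positivity
  have key := Convex.norm_image_sub_le_of_norm_hasDerivWithin_le (𝕜 := ℝ)
    (s := {r : ℝ | |r - l| ≤ τ}) (x := l) (y := l + t)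
    (f := fun σ => 𝓕 (fun s => b s σ) ξ) (f' := fun σ => 𝓕 (fun s => deriv (b s) σ) ξ)
    (C := 4 * R * M * ((1 + τ) / (1 + |l|)) / (1 + τ ^ 4))
    (fun σ _ => (phi_deriv hb σ ξ).hasDerivWithinAt) ?_ ?_ (by simpa using hτ0) (by simpa using ht)
  · refine key.trans ?_
    rw [add_sub_cancel_left, norm_eq_abs, e2]
    calc _ ≤ 4 * R * M * ((1 + τ) / (1 + |l|)) / (1 + τ ^ 4) * τ := by gcongr
      _ = (4 * R * M / (1 + |l|)) * ((1 + τ) * τ / (1 + τ ^ 4)) := by ring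
      _ ≤ (4 * R * M / (1 + |l|)) * (4 * (1 + τ ^ 2)⁻¹) := by
          gcongr
          rw [← div_eq_mul_inv, div_le_div_iff₀ (by positivity) (by positivity)]
          nlinarith [sq_nonneg (τ - 1), sq_nonneg (τ ^ 2 - 1), sq_nonneg (τ ^ 2 - τ), sq_nonneg (τ^2), mul_nonneg hτ0 (sq_nonneg (τ - 1)), mul_nonneg hτ0 hτ0]
      _ = _ := by ring
  · intro σ hσ
    refine (dphi_decay hR hb σ ξ).trans ?_
    rw [e4]
    have hp := peetre_s6 l (σ - l)
    rw [add_sub_cancel] at hp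
    have : (1 + |σ|)⁻¹ ≤ (1 + τ) / (1 + |l|) := by
      refine hp.trans ?_
      gcongr
      exact hσ
    rw [div_eq_mul_inv M, ← mul_assoc]
    gcongr
  · have : {r : ℝ | |r - l| ≤ τ} = Metric.closedBall l τ := by
      ext r; simp [Metric.mem_closedBall, Real.dist_eq]
    rw [this]; exact convex_closedBall _ _

lemma sq_integrable : Integrable (fun ξ : ℝ => (1 + (2 * π * ξ) ^ 2)⁻¹) :=
  integrable_inv_one_add_sq.comp_mul_left' (by positivity : (2 * π) ≠ 0)

lemma phi_meas {R M : ℝ} {b : ℝ → ℝ → ℂ} (hb : Good R M b) (l c : ℝ) :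
    AEStronglyMeasurable (fun ξ : ℝ => 𝓕 (fun s => b s (l + c * ξ)) ξ) volume := by
  simp only [Real.fourier_real_eq_integral_exp_smul]
  apply StronglyMeasurable.aestronglyMeasurable
  apply StronglyMeasurable.integral_prod_right'
    (f := fun q : ℝ × ℝ => Complex.exp (↑(-2 * π * q.2 * q.1) * Complex.I) • b q.2 (l + c * q.1))
  apply Continuous.stronglyMeasurable
  have h := hb.1.continuous
  have h2 : Continuous fun q : ℝ × ℝ => b q.2 (l + c * q.1) :=
    h.comp (f := fun q : ℝ × ℝ => (q.2, l + c * q.1)) (by fun_prop)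
  fun_prop

lemma phi_int {R M : ℝ} (hR : 0 < R) {b : ℝ → ℝ → ℂ} (hb : Good R M b) (l c : ℝ) :
    Integrable (fun ξ : ℝ => 𝓕 (fun s => b s (l + c * ξ)) ξ) := by
  refine (sq_integrable.const_mul (8 * R * M)).mono' (phi_meas hb l c) ?_
  refine Filter.Eventually.of_forall fun ξ => (phi_decay hR hb _ ξ).trans ?_
  have hM := good_M hb
  rw [← div_eq_mul_inv, div_le_div_iff₀ (by positivity) (by positivity)]
  have : 1 + (2 * π * ξ) ^ 2 ≤ 2 * (1 + (2 * π * ξ) ^ 4) := by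
    nlinarith [sq_nonneg ((2 * π * ξ) ^ 2 - 1)]
  calc _ ≤ 4 * R * M * (2 * (1 + (2 * π * ξ) ^ 4)) := by gcongr
    _ = _ := by ring

lemma one_dim {R M : ℝ} (hR : 0 < R) {b : ℝ → ℝ → ℂ} (hb : Good R M b) (l : ℝ) :
    ‖(∫ σ, 𝓕 (fun s => b s σ) ((l - σ) / (2 * π))) - 2 * π * b 0 l‖
      ≤ 2 * π * (16 * R * M * ∫ ξ : ℝ, (1 + (2 * π * ξ) ^ 2)⁻¹) / (1 + |l|) := by
  have hpi := pi_pos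
  have h1 : (∫ σ, 𝓕 (fun s => b s σ) ((l - σ) / (2 * π)))
      = 2 * π * ∫ ξ : ℝ, 𝓕 (fun s => b s (l + (-2 * π) * ξ)) ξ := by
    rw [← integral_add_left_eq_self _ l]
    have := Measure.integral_comp_mul_left
      (fun σ => 𝓕 (fun s => b s (l + σ)) ((l - (l + σ)) / (2 * π))) (-2 * π)
    have e : ∀ ξ : ℝ, (l - (l + -2 * π * ξ)) / (2 * π) = ξ := by
      intro ξ; field_simp; ring
    simp only [e] at this
    rw [this, abs_inv, abs_of_neg (by linarith), Complex.real_smul]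
    push_cast
    rw [← mul_assoc]
    have : (2 * (π : ℂ)) * (-(-2 * (π : ℂ)))⁻¹ = 1 := by
      have : (π : ℂ) ≠ 0 := by exact_mod_cast hpi.ne'
      field_simp
    rw [this, one_mul]
  have hi0 : Integrable (fun ξ : ℝ => 𝓕 (fun s => b s l) ξ) := by
    simpa using phi_int hR hb l 0
  have h2 : b 0 l = ∫ ξ : ℝ, 𝓕 (fun s => b s l) ξ := by
    have hc := (good_slice hb l).continuous
    have := congrFun (hc.fourierInv_fourier_eq
      (supp_integrable _ hc R (fun s h => hb.2.1 s l h)) hi0) 0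
    rw [← this, Real.fourierInv_eq']
    simp
  rw [h1, h2, ← mul_sub, ← integral_sub (phi_int hR hb _ _) hi0, norm_mul]
  have : ‖2 * (π : ℂ)‖ = 2 * π := by simp [abs_of_pos hpi]
  rw [this, mul_div_assoc]
  gcongr
  calc _ ≤ ∫ ξ : ℝ, 16 * R * M / (1 + |l|) * (1 + (2 * π * ξ) ^ 2)⁻¹ := by
        apply norm_integral_le_of_norm_le (sq_integrable.const_mul _)
        refine Filter.Eventually.of_forall fun ξ => phi_diff hR hb l _ ξ (le_of_eq ?_)
        rw [← abs_neg]; ring_nf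
    _ = _ := by rw [integral_const_mul]; ring

lemma mod_deriv (h p : ℝ) (f : ℝ → ℂ) (hf : Differentiable ℝ f) :
    deriv (fun s => Complex.exp (-Complex.I * Complex.ofReal (h * s * p)) * f s)
      = fun s => Complex.exp (-Complex.I * Complex.ofReal (h * s * p)) *
        (deriv f s - Complex.I * (h * p) * f s) := by
  ext s
  have h0 : HasDerivAt (fun s : ℝ => -Complex.I * Complex.ofReal (h * s * p))
      (-Complex.I * (h * p)) s := by
    have : HasDerivAt (fun s : ℝ => h * s * p) (h * p) s := by
      simpa using ((hasDerivAt_id s).const_mul h).mul_const p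
    have := this.ofReal_comp.const_mul (-Complex.I)
    push_cast at this ⊢
    exact this
  have h1 : HasDerivAt (fun s => Complex.exp (-Complex.I * Complex.ofReal (h * s * p)) * f s) _ s :=
    h0.cexp.mul (hf s).hasDerivAt
  rw [h1.deriv]
  ring

lemma mod_oneAdd (h p : ℝ) (f : ℝ → ℂ) (hf : ContDiff ℝ ∞ f) (s : ℝ) :
    oneAddDsq (fun s => Complex.exp (-Complex.I * Complex.ofReal (h * s * p)) * f s) s
      = Complex.exp (-Complex.I * Complex.ofReal (h * s * p)) *
        ((1 + (h * p) ^ 2) * f s + 2 * Complex.I * (h * p) * deriv f s - deriv (deriv f) s) := by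
  have d1 : Differentiable ℝ f := hf.differentiable (by simp)
  have d2 : ContDiff ℝ ∞ (deriv f) := ((contDiff_infty_iff_deriv (𝕜 := ℝ)).mp hf).2
  have d2' : Differentiable ℝ (deriv f) := d2.differentiable (by simp)
  rw [oneAddDsq, mod_deriv h p f d1, mod_deriv h p (fun s => deriv f s - Complex.I * (h * p) * f s)
    (d2'.sub (d1.const_mul _))]
  simp only
  have : deriv (fun s => deriv f s - Complex.I * (h * p) * f s) s
      = deriv (deriv f) s - Complex.I * (h * p) * deriv f s :=
    (((d2' s).hasDerivAt).sub ((d1 s).hasDerivAt.const_mul _)).deriv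
  rw [this]
  ring_nf
  rw [Complex.I_sq]; ring

lemma mod_norm (h p s : ℝ) : ‖Complex.exp (-Complex.I * Complex.ofReal (h * s * p))‖ = 1 := by
  rw [Complex.norm_exp]; simp

lemma mod_bound {R M : ℝ} {b : ℝ → ℝ → ℂ} (hb : Good R M b) (h p s σ : ℝ) :
    ‖oneAddDsq (fun s => Complex.exp (-Complex.I * Complex.ofReal (h * s * p)) * b s σ) s‖
      ≤ (2 + (h * p) ^ 2 + 2 * |h * p|) * M := by
  rw [mod_oneAdd h p _ (good_slice hb σ), norm_mul, mod_norm, one_mul]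
  have a0 := hb.2.2.1 0 (by simp) s σ
  have a1 := hb.2.2.1 1 (by simp) s σ
  have a2 := hb.2.2.1 2 (by simp) s σ
  rw [iteratedDeriv_zero] at a0
  rw [iteratedDeriv_one] at a1
  rw [iteratedDeriv_succ, iteratedDeriv_one] at a2
  refine (norm_sub_le _ _).trans ?_
  have b0 : ‖(1 + ((h : ℂ) * p) ^ 2) * b s σ‖ ≤ (1 + (h * p) ^ 2) * M := by
    rw [norm_mul]
    have : ‖(1 + ((h : ℂ) * p) ^ 2)‖ = 1 + (h * p) ^ 2 := by
      have : (1 + ((h : ℂ) * p) ^ 2) = ((1 + (h * p) ^ 2 : ℝ) : ℂ) := by push_cast; ring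
      rw [this, Complex.norm_real, norm_eq_abs, abs_of_pos (by positivity)]
    rw [this]; gcongr
  have b1 : ‖2 * Complex.I * ((h : ℂ) * p) * deriv (fun s => b s σ) s‖ ≤ 2 * |h * p| * M := by
    rw [norm_mul]
    have : ‖2 * Complex.I * ((h : ℂ) * p)‖ = 2 * |h * p| := by
      simp [abs_mul]
    rw [this]; gcongr
  have := norm_add_le ((1 + ((h : ℂ) * p) ^ 2) * b s σ) (2 * Complex.I * ((h : ℂ) * p) * deriv (fun s => b s σ) s)
  linarith

lemma mod_fourier {R M : ℝ} {b : ℝ → ℝ → ℂ} (hb : Good R M b) (h p σ : ℝ) :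
    ∫ s : ℝ, Complex.exp (Complex.I * Complex.ofReal (s * σ)) * (Complex.ofReal (1 + σ ^ 2))⁻¹ *
      oneAddDsq (fun s => Complex.exp (-Complex.I * Complex.ofReal (h * s * p)) * b s σ) s
    = 𝓕 (fun s => b s σ) ((h * p - σ) / (2 * π)) := by
  have hpi := pi_pos
  have hpi' : (π : ℂ) ≠ 0 := by exact_mod_cast hpi.ne'
  set F : ℝ → ℂ := fun s => Complex.exp (-Complex.I * Complex.ofReal (h * s * p)) * b s σ with hF
  have hFs : ∀ s, R < |s| → F s = 0 := fun s hs => by simp [hF, hb.2.1 s σ hs]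
  have hFc : ContDiff ℝ ∞ F := by
    have := good_slice hb σ
    have h2 : ContDiff ℝ ∞ (fun s : ℝ => Complex.ofReal (h * s * p)) :=
      Complex.ofRealCLM.contDiff.comp ((contDiff_const.mul contDiff_id).mul contDiff_const)
    exact (contDiff_const.mul h2).cexp.mul this
  have key := fourier_iter F hFc R hFs 2 (-σ / (2 * π))
  have e2 : iteratedDeriv 2 F = deriv (deriv F) := by rw [iteratedDeriv_succ, iteratedDeriv_one]
  have hexp : ∀ s : ℝ, Complex.exp (↑(-2 * π * s * (-σ / (2 * π))) * Complex.I)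
      = Complex.exp (Complex.I * Complex.ofReal (s * σ)) := by
    intro s
    congr 1
    have : -2 * π * s * (-σ / (2 * π)) = s * σ := by field_simp
    rw [this, mul_comm]
  have hi : ∀ k, Integrable fun s : ℝ => Complex.exp (Complex.I * Complex.ofReal (s * σ)) * iteratedDeriv k F s := by
    intro k
    have hc := hFc.continuous_iteratedDeriv k (by exact_mod_cast le_top)
    apply supp_integrable _ (by fun_prop) R
    intro s hs
    rw [supp_iter F R hFs k s hs, mul_zero]
  have hcoef : (2 * (π : ℂ) * Complex.I * ((-σ / (2 * π) : ℝ) : ℂ)) ^ 2 = - (σ : ℂ) ^ 2 := by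
    have : (2 * (π : ℂ) * Complex.I * ((-σ / (2 * π) : ℝ) : ℂ)) = - Complex.I * σ := by
      push_cast; field_simp
    rw [this]; ring_nf; rw [Complex.I_sq]; ring
  rw [hcoef] at key
  have h0 : 𝓕 F (-σ / (2 * π)) = 𝓕 (fun s => b s σ) ((h * p - σ) / (2 * π)) := by
    simp only [Real.fourier_real_eq_integral_exp_smul, hexp, hF, smul_eq_mul]
    congr 1; ext s
    rw [← mul_assoc, ← Complex.exp_add]
    congr 2
    have : -2 * π * s * ((h * p - σ) / (2 * π)) = s * σ - h * s * p := by field_simp; ring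
    rw [this]; push_cast; ring
  rw [← h0]
  have hne : (Complex.ofReal (1 + σ ^ 2)) ≠ 0 := by
    rw [Complex.ofReal_ne_zero]; positivity
  have : ∀ s : ℝ, Complex.exp (Complex.I * Complex.ofReal (s * σ)) * (Complex.ofReal (1 + σ ^ 2))⁻¹ * oneAddDsq F s
      = (Complex.ofReal (1 + σ ^ 2))⁻¹ * (Complex.exp (Complex.I * Complex.ofReal (s * σ)) * iteratedDeriv 0 F s - Complex.exp (Complex.I * Complex.ofReal (s * σ)) * iteratedDeriv 2 F s) := by
    intro s
    rw [oneAddDsq, e2, iteratedDeriv_zero]; ring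
  simp only [this]
  rw [integral_const_mul, integral_sub (hi 0) (hi 2)]
  have k0 : ∀ k, ∫ s : ℝ, Complex.exp (Complex.I * Complex.ofReal (s * σ)) * iteratedDeriv k F s = 𝓕 (iteratedDeriv k F) (-σ / (2 * π)) := by
    intro k
    simp only [Real.fourier_real_eq_integral_exp_smul, hexp, smul_eq_mul]
  rw [k0, k0, key, iteratedDeriv_zero, smul_eq_mul, inv_mul_eq_iff_eq_mul₀ hne]
  push_cast; ring

lemma slice_bound_s6 {E : Type*} [NormedAddCommGroup E] [NormedSpace ℝ E] (g : ℝ × E → ℂ)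
    (hg : ContDiff ℝ ∞ g) (k : ℕ) (y : E) (s : ℝ) :
    ‖iteratedDeriv k (fun s => g (s, y)) s‖ ≤ ‖iteratedFDeriv ℝ k g (s, y)‖ := by
  rw [← norm_iteratedFDeriv_eq_norm_iteratedDeriv]
  set g' : ℝ × E → ℂ := fun w => g (w + (0, y)) with hg'
  have hg'c : ContDiff ℝ ∞ g' := hg.comp (contDiff_id.add contDiff_const)
  have e : (fun s => g (s, y)) = g' ∘ (ContinuousLinearMap.inl ℝ ℝ E) := by
    ext s; simp [hg']
  rw [e, ContinuousLinearMap.iteratedFDeriv_comp_right _ hg'c _ (by exact_mod_cast le_top),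
    hg', iteratedFDeriv_comp_add_right]
  refine (ContinuousMultilinearMap.norm_compContinuousLinearMap_le _ _).trans ?_
  have : (ContinuousLinearMap.inl ℝ ℝ E) s + (0, y) = (s, y) := by simp
  rw [this]
  refine mul_le_of_le_one_right (norm_nonneg _) ?_
  apply Finset.prod_le_one
  · intros; exact norm_nonneg _
  · intros; exact ContinuousLinearMap.norm_inl_le_one ℝ ℝ E

lemma joint_deriv {E : Type*} [NormedAddCommGroup E] [NormedSpace ℝ E]
    (g : (ℝ × E) × ℝ → ℂ) (hg : ContDiff ℝ ∞ g) :
    ∃ g' : (ℝ × E) × ℝ → ℂ, ContDiff ℝ ∞ g' ∧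
      ∀ s y σ, deriv (fun s => g ((s, y), σ)) s = g' ((s, y), σ) := by
  refine ⟨fun q => fderiv ℝ g q ((1, 0), 0),
    (hg.fderiv_right (m := ∞) (by simp)).clm_apply contDiff_const, ?_⟩
  intro s y σ
  have h1 : HasFDerivAt g (fderiv ℝ g ((s, y), σ)) ((s, y), σ) :=
    (hg.differentiable (by simp) _).hasFDerivAt
  have h2 : HasDerivAt (fun s : ℝ => ((s, y), σ)) (((1 : ℝ), (0 : E)), (0 : ℝ)) s :=
    ((hasDerivAt_id s).prodMk (hasDerivAt_const s y)).prodMk (hasDerivAt_const s σ)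
  exact (h1.comp_hasDerivAt s h2).deriv

lemma good_of_amp (n : ℕ)
    (a : (ℝ × (Fin (n+1) → ℝ) × (Fin (n+1) → ℝ) × (Fin (n+1) → ℝ)) → ℝ → ℂ)
    (ha : IsAmplitude n 0 a) :
    ∃ M R0 : ℝ, ∀ R, R0 ≤ R → 0 < R → (∀ x p, Good R M (fun s σ => a (s, x, x, p) σ)) ∧
      (∀ s x p σ, (R < ‖x‖ ∨ R < ‖p‖) → a (s, x, x, p) σ = 0) := by
  obtain ⟨hc, ⟨K, hK, hKs⟩, hbd⟩ := ha
  obtain ⟨R0, hR0⟩ := hK.isBounded.exists_norm_le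
  choose Cf hCf using hbd
  have hsup : ∀ R, R0 ≤ R → ∀ s x y p σ, (R < |s| ∨ R < ‖x‖ ∨ R < ‖p‖) → a (s, x, y, p) σ = 0 := by
    intro R hR s x y p σ h
    apply hKs
    intro hmem
    have := (hR0 _ hmem).trans hR
    simp only [Prod.norm_def, sup_le_iff, norm_eq_abs] at this
    rcases h with h | h | h <;> linarith [this.1, this.2.1, this.2.2.2]
  have hd : ∀ σ, ContDiff ℝ ∞ fun w => deriv (a w) σ := by
    intro σ
    have : (fun w => deriv (a w) σ) = fun w =>
        fderiv ℝ (fun q : (ℝ × (Fin (n+1) → ℝ) × (Fin (n+1) → ℝ) × (Fin (n+1) → ℝ)) × ℝ => a q.1 q.2)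
          (w, σ) (0, 1) := by
      ext w
      have h1 := (hc.differentiable (by simp) (w, σ)).hasFDerivAt
      have h2 : HasDerivAt (fun σ : ℝ => (w, σ)) ((0 : ℝ × (Fin (n+1) → ℝ) × (Fin (n+1) → ℝ) × (Fin (n+1) → ℝ)), (1 : ℝ)) σ :=
        (hasDerivAt_const σ w).prodMk (hasDerivAt_id σ)
      exact (h1.comp_hasDerivAt σ h2).deriv
    rw [this]
    exact ((hc.fderiv_right (m := ∞) (by simp)).clm_apply contDiff_const).comp
      (contDiff_id.prodMk contDiff_const)
  have ha0 : ∀ σ, ContDiff ℝ ∞ fun w => a w σ := fun σ =>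
    ContDiff.comp (f := fun w => (w, σ)) hc (contDiff_id.prodMk contDiff_const)
  set M : ℝ := ∑ k ∈ Finset.range 5, (|Cf k 0| + |Cf k 1|) with hM
  have hM0 : ∀ k ≤ 4, |Cf k 0| + |Cf k 1| ≤ M := fun k hk =>
    Finset.single_le_sum (f := fun k => |Cf k 0| + |Cf k 1|) (fun i _ => by positivity)
      (Finset.mem_range.mpr (by omega))
  refine ⟨M, R0, fun R hR hRp => ⟨fun x p => ⟨?_, ?_, ?_, ?_⟩, ?_⟩⟩
  · exact ContDiff.comp (f := fun q : ℝ × ℝ => ((q.1, x, x, p), q.2)) hc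
      ((contDiff_fst.prodMk contDiff_const).prodMk contDiff_snd)
  · intro s σ hs
    exact hsup R hR _ _ _ _ _ (Or.inl hs)
  · intro k hk s σ
    refine (slice_bound_s6 (fun w => a w σ) (ha0 σ) k (x, x, p) s).trans ?_
    have := hCf k 0 (s, x, x, p) σ
    simp only [iteratedDeriv_zero, Nat.cast_zero, sub_zero, rpow_zero, mul_one] at this
    linarith [le_abs_self (Cf k 0), abs_nonneg (Cf k 1), hM0 k hk]
  · intro k hk s σ
    refine (slice_bound_s6 (fun w => deriv (a w) σ) (hd σ) k (x, x, p) s).trans ?_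
    have := hCf k 1 (s, x, x, p) σ
    simp only [iteratedDeriv_one, Nat.cast_one, zero_sub, rpow_neg_one] at this
    refine this.trans ?_
    rw [← div_eq_mul_inv]
    gcongr
    linarith [le_abs_self (Cf k 1), abs_nonneg (Cf k 0), hM0 k hk]
  · intro s x p σ h
    exact hsup R hR _ _ _ _ _ (Or.inr h)

/-- the integrand on the diagonal, reordered -/
def Hd (n : ℕ)
    (a : (ℝ × (Fin (n+1) → ℝ) × (Fin (n+1) → ℝ) × (Fin (n+1) → ℝ)) → ℝ → ℂ) (h : ℝ)
    (x p : Fin (n+1) → ℝ) (σ s : ℝ) : ℂ :=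
  Complex.exp (Complex.I * Complex.ofReal (s * σ)) * (Complex.ofReal (1 + σ ^ 2))⁻¹ *
      oneAddDsq (fun s => Complex.exp (-Complex.I * Complex.ofReal (h * s * p 0)) *
        a (s, x, x, p) σ) s

lemma osc_eq (n : ℕ)
    (a : (ℝ × (Fin (n+1) → ℝ) × (Fin (n+1) → ℝ) × (Fin (n+1) → ℝ)) → ℝ → ℂ) (h : ℝ)
    (x : Fin (n+1) → ℝ) (q : ℝ × (Fin (n+1) → ℝ) × ℝ) :
    oscIntegrand n a h x x (⌈(0 : ℝ) / 2 + 1⌉₊) q = Hd n a h⁻¹ x q.2.1 q.2.2 q.1 := by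
  have : ⌈(0 : ℝ) / 2 + 1⌉₊ = 1 := by norm_num
  rw [this, oscIntegrand, Hd]
  simp

lemma Hd_cont (n : ℕ)
    (a : (ℝ × (Fin (n+1) → ℝ) × (Fin (n+1) → ℝ) × (Fin (n+1) → ℝ)) → ℝ → ℂ)
    (ha : IsAmplitude n 0 a) (h : ℝ) :
    Continuous fun q : (((Fin (n+1) → ℝ) × (Fin (n+1) → ℝ)) × ℝ) × ℝ =>
      Hd n a h q.1.1.1 q.1.1.2 q.1.2 q.2 := by
  have hc := ha.1
  obtain ⟨a1, ha1, e1⟩ := joint_deriv _ hc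
  obtain ⟨a2, ha2, e2⟩ := joint_deriv _ ha1
  have key : ∀ x p σ s, Hd n a h x p σ s =
      Complex.exp (Complex.I * Complex.ofReal (s * σ)) * (Complex.ofReal (1 + σ ^ 2))⁻¹ *
       (Complex.exp (-Complex.I * Complex.ofReal (h * s * p 0)) *
        ((1 + (h * p 0) ^ 2) * a (s, x, x, p) σ + 2 * Complex.I * (h * p 0) *
          a1 ((s, x, x, p), σ) - a2 ((s, x, x, p), σ))) := by
    intro x p σ s
    have hs : ContDiff ℝ ∞ (fun s => a (s, x, x, p) σ) :=
      ContDiff.comp (f := fun s : ℝ => ((s, x, x, p), σ)) hc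
        ((contDiff_id.prodMk contDiff_const).prodMk contDiff_const)
    have d1 : deriv (fun s => a (s, x, x, p) σ) = fun s => a1 ((s, x, x, p), σ) := by
      ext s; exact e1 s (x, x, p) σ
    rw [Hd, mod_oneAdd h (p 0) _ hs, d1, e2]
  simp only [key]
  have c0 : Continuous fun q : (((Fin (n+1) → ℝ) × (Fin (n+1) → ℝ)) × ℝ) × ℝ =>
      a (q.2, q.1.1.1, q.1.1.1, q.1.1.2) q.1.2 :=
    hc.continuous.comp (f := fun q : (((Fin (n+1) → ℝ) × (Fin (n+1) → ℝ)) × ℝ) × ℝ =>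
      ((q.2, q.1.1.1, q.1.1.1, q.1.1.2), q.1.2)) (by fun_prop)
  have c1 := ha1.continuous
  have c2 := ha2.continuous
  have c3 : Continuous fun q : (((Fin (n+1) → ℝ) × (Fin (n+1) → ℝ)) × ℝ) × ℝ =>
      (Complex.ofReal (1 + q.1.2 ^ 2))⁻¹ := by
    apply Continuous.inv₀ (by fun_prop)
    intro q
    rw [Complex.ofReal_ne_zero]; positivity
  fun_prop

lemma Hd_zero (n : ℕ)
    (a : (ℝ × (Fin (n+1) → ℝ) × (Fin (n+1) → ℝ) × (Fin (n+1) → ℝ)) → ℝ → ℂ) (h : ℝ)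
    (x p : Fin (n+1) → ℝ) (σ s : ℝ) (h0 : ∀ s, a (s, x, x, p) σ = 0) : Hd n a h x p σ s = 0 := by
  simp [Hd, h0, oneAddDsq]

lemma Hd_zero' (n : ℕ)
    (a : (ℝ × (Fin (n+1) → ℝ) × (Fin (n+1) → ℝ) × (Fin (n+1) → ℝ)) → ℝ → ℂ) (h : ℝ)
    (x p : Fin (n+1) → ℝ) (σ s R : ℝ) (h0 : ∀ s, R < |s| → a (s, x, x, p) σ = 0)
    (hs : R < |s|) : Hd n a h x p σ s = 0 := by
  have hF : ∀ s, R < |s| → (fun s : ℝ => Complex.exp (-Complex.I * Complex.ofReal (h * s * p 0)) *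
        a (s, x, x, p) σ) s = 0 := by
    intro s hs; simp [h0 s hs]
  have h2 := supp_iter _ R hF 2 s hs
  rw [iteratedDeriv_succ, iteratedDeriv_one] at h2
  rw [Hd, oneAddDsq, h2]
  simp [h0 s hs]

lemma Hd_integrable (n : ℕ)
    (a : (ℝ × (Fin (n+1) → ℝ) × (Fin (n+1) → ℝ) × (Fin (n+1) → ℝ)) → ℝ → ℂ)
    (ha : IsAmplitude n 0 a) (h R M : ℝ)
    (hG : ∀ x p, Good R M (fun s σ => a (s, x, x, p) σ))
    (hz : ∀ s x p σ, (R < ‖x‖ ∨ R < ‖p‖) → a (s, x, x, p) σ = 0) (x : Fin (n+1) → ℝ) :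
    Integrable fun q : ℝ × (Fin (n+1) → ℝ) × ℝ => Hd n a h x q.2.1 q.2.2 q.1 := by
  have hM := good_M (hG 0 0)
  set D : ℝ := (2 + (|h| * R) ^ 2 + 2 * (|h| * R)) * M with hD
  have i1 : Integrable ((Set.Icc (-R) R).indicator (fun _ => D)) := by
    rw [integrable_indicator_iff measurableSet_Icc]
    exact integrableOn_const (by simp)
  have i2 : Integrable ((Metric.closedBall (0 : Fin (n+1) → ℝ) R).indicator (fun _ => (1 : ℝ))) := by
    rw [integrable_indicator_iff Metric.isClosed_closedBall.measurableSet]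
    exact integrableOn_const (measure_closedBall_lt_top.ne)
  have i3 := i1.mul_prod (i2.mul_prod integrable_inv_one_add_sq)
  refine i3.mono' ?_ ?_
  · apply Continuous.aestronglyMeasurable
    exact (Hd_cont n a ha h).comp (f := fun q : ℝ × (Fin (n+1) → ℝ) × ℝ => (((x, q.2.1), q.2.2), q.1))
      (by fun_prop)
  · refine Filter.Eventually.of_forall fun q => ?_
    obtain ⟨s, p, σ⟩ := q
    simp only
    by_cases hs : s ∈ Set.Icc (-R) R
    swap
    · rw [Hd_zero' n a h x p σ s R (fun s hs => (hG x p).2.1 s σ hs), Set.indicator_of_notMem hs]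
      · simp
      · by_contra hc
        exact hs (abs_le.mp (not_lt.mp hc))
    by_cases hp : p ∈ Metric.closedBall (0 : Fin (n+1) → ℝ) R
    swap
    · rw [Hd_zero n a h x p σ s, Set.indicator_of_notMem hp]
      · simp
      · intro s
        apply hz; right
        simpa using hp
    rw [Set.indicator_of_mem hs, Set.indicator_of_mem hp, one_mul, Hd, norm_mul, norm_mul]
    have e1 : ‖Complex.exp (Complex.I * Complex.ofReal (s * σ))‖ = 1 := by
      rw [Complex.norm_exp]; simp
    have e2 : ‖(Complex.ofReal (1 + σ ^ 2))⁻¹‖ = (1 + σ ^ 2)⁻¹ := by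
      rw [norm_inv, Complex.norm_real, norm_eq_abs, abs_of_pos (by positivity)]
    rw [e1, e2, one_mul, mul_comm]
    gcongr
    refine (mod_bound (hG x p) h (p 0) s σ).trans ?_
    have hp0 : |h * p 0| ≤ |h| * R := by
      rw [abs_mul]
      gcongr
      have := norm_le_pi_norm p 0
      rw [norm_eq_abs] at this
      exact this.trans (by simpa using hp)
    rw [hD, ← sq_abs (h * p 0)]
    gcongr

lemma uh_eq (n : ℕ)
    (a : (ℝ × (Fin (n+1) → ℝ) × (Fin (n+1) → ℝ) × (Fin (n+1) → ℝ)) → ℝ → ℂ)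
    (ha : IsAmplitude n 0 a) (h R M : ℝ)
    (hG : ∀ x p, Good R M (fun s σ => a (s, x, x, p) σ))
    (hz : ∀ s x p σ, (R < ‖x‖ ∨ R < ‖p‖) → a (s, x, x, p) σ = 0) (x : Fin (n+1) → ℝ) :
    uh n 0 a h x x = Complex.ofReal ((2 * π * h) ^ (-((n : ℤ) + 1))) *
      ∫ p : Fin (n+1) → ℝ, ∫ σ : ℝ, ∫ s : ℝ, Hd n a h⁻¹ x p σ s := by
  have hi := Hd_integrable n a ha h⁻¹ R M hG hz x
  rw [uh]
  simp only [osc_eq]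
  congr 1
  rw [Measure.volume_eq_prod] at hi ⊢
  rw [integral_prod_symm _ hi]
  have := hi.integral_prod_right
  rw [Measure.volume_eq_prod] at this ⊢
  rw [integral_prod _ this]

lemma int_log (h R : ℝ) (hh : 0 < h) (hR : 0 < R) :
    ∫ t : ℝ, (Set.Icc (-R) R).indicator (fun t => (1 + |h * t|)⁻¹) t = 2 * (Real.log (1 + h * R) / h) := by
  have e : ∀ t : ℝ, (Set.Icc (-R) R).indicator (fun t => (1 + |h * t|)⁻¹) t
      = (fun u => (Set.Iic R).indicator (fun u => (1 + h * u)⁻¹) u) |t| := by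
    intro t
    simp only [Set.indicator_apply, Set.mem_Icc, Set.mem_Iic, abs_le, abs_mul, abs_of_pos hh]
  simp only [e]
  rw [integral_comp_abs (f := fun u => (Set.Iic R).indicator (fun u => (1 + h * u)⁻¹) u)]
  congr 1
  rw [setIntegral_indicator measurableSet_Iic, Set.Ioi_inter_Iic,
    ← intervalIntegral.integral_of_le hR.le]
  have hd : ∀ t ∈ Set.uIcc 0 R, HasDerivAt (fun t => Real.log (1 + h * t) / h) (1 + h * t)⁻¹ t := by
    intro t ht
    rw [Set.uIcc_of_le hR.le] at ht
    have hpos : 0 < 1 + h * t := by have := mul_nonneg hh.le ht.1; linarith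
    have h1 : HasDerivAt (fun t => 1 + h * t) h t := by
      simpa using ((hasDerivAt_id t).const_mul h).const_add 1
    have := (h1.log hpos.ne').div_const h
    rw [div_right_comm, div_self hh.ne', one_div] at this
    exact this
  rw [intervalIntegral.integral_eq_sub_of_hasDerivAt hd]
  · simp
  · apply ContinuousOn.intervalIntegrable
    apply ContinuousOn.inv₀ (by fun_prop)
    intro t ht
    rw [Set.uIcc_of_le hR.le] at ht
    have := mul_nonneg hh.le ht.1
    linarith

/-- the weight in the variable `p` -/
def wt (n : ℕ) (h R : ℝ) (p : Fin (n+1) → ℝ) : ℝ :=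
  ∏ i, (Set.Icc (-R) R).indicator (fun t => if i = 0 then (1 + |h * t|)⁻¹ else 1) (p i)

lemma wt_nonneg (n : ℕ) (h R : ℝ) (p : Fin (n+1) → ℝ) : 0 ≤ wt n h R p := by
  apply Finset.prod_nonneg
  intro i _
  apply Set.indicator_nonneg
  intro t _
  split_ifs
  · positivity
  · norm_num

lemma wt_eq (n : ℕ) (h R : ℝ) (p : Fin (n+1) → ℝ) (hp : ‖p‖ ≤ R) :
    wt n h R p = (1 + |h * p 0|)⁻¹ := by
  have hm : ∀ i, p i ∈ Set.Icc (-R) R := by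
    intro i
    have := (norm_le_pi_norm p i).trans hp
    exact abs_le.mp this
  simp [wt, Set.indicator_of_mem (hm _)]

lemma wt_integrable (n : ℕ) (h R : ℝ) : Integrable (wt n h R) := by
  apply Integrable.fintype_prod
    (f := fun (i : Fin (n+1)) (t : ℝ) => (Set.Icc (-R) R).indicator (fun t => if i = 0 then (1 + |h * t|)⁻¹ else 1) t)
  intro i
  rw [integrable_indicator_iff measurableSet_Icc]
  apply ContinuousOn.integrableOn_Icc
  split_ifs
  · apply ContinuousOn.inv₀ (by fun_prop)
    intro t _; positivity
  · fun_prop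

lemma wt_integral (n : ℕ) (h R : ℝ) (hh : 0 < h) (hR : 0 < R) :
    ∫ p, wt n h R p = 2 * (Real.log (1 + h * R) / h) * (2 * R) ^ n := by
  simp only [wt]
  rw [integral_fintype_prod_volume_eq_prod
    (f := fun (i : Fin (n+1)) (t : ℝ) => (Set.Icc (-R) R).indicator (fun t => if i = 0 then (1 + |h * t|)⁻¹ else 1) t),
    Fin.prod_univ_succ]
  simp only [if_true]
  rw [int_log h R hh hR]
  congr 1
  have : ∀ i : Fin n, ∫ t : ℝ, (Set.Icc (-R) R).indicator (fun t => if i.succ = 0 then (1 + |h * t|)⁻¹ else 1) t = 2 * R := by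
    intro i
    simp only [Fin.succ_ne_zero, if_false]
    rw [integral_indicator measurableSet_Icc, setIntegral_const]
    simp [Measure.real]
    rw [ENNReal.toReal_ofReal (by linarith)]; ring
  rw [Finset.prod_congr rfl (fun i _ => this i)]
  simp


lemma L_meas (n : ℕ)
    (a : (ℝ × (Fin (n+1) → ℝ) × (Fin (n+1) → ℝ) × (Fin (n+1) → ℝ)) → ℝ → ℂ)
    (ha : IsAmplitude n 0 a) (h : ℝ) :
    AEStronglyMeasurable (fun xp : (Fin (n+1) → ℝ) × (Fin (n+1) → ℝ) =>
      ∫ σ : ℝ, ∫ s : ℝ, Hd n a h xp.1 xp.2 σ s) volume := by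
  have h1 := (Hd_cont n a ha h).stronglyMeasurable
  have h2 := h1.integral_prod_right' (ν := (volume : Measure ℝ))
  have h3 := h2.integral_prod_right' (ν := (volume : Measure ℝ))
  exact h3.aestronglyMeasurable

/-- trace asymptotics with homogeneous leading term, `m' = 0`:
as `ℏ → 0⁺`,
`∫ u_ℏ(x,x) dx = (2π)^{1-(n+1)} ℏ^{-(n+1)} ∫ (ã₊ 𝟙_{p₁>0} + ã₋ 𝟙_{p₁<0}) dx dp
 + O(ℏ^{-(n+1)+1} log(1/ℏ))`. -/
theorem statement6 (n : ℕ)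
    (a : (ℝ × (Fin (n+1) → ℝ) × (Fin (n+1) → ℝ) × (Fin (n+1) → ℝ)) → ℝ → ℂ)
    (ha : IsAmplitude n 0 a)
    (aP aM : (Fin (n+1) → ℝ) × (Fin (n+1) → ℝ) → ℂ)
    (haPc : Continuous aP) (haPs : HasCompactSupport aP)
    (haMc : Continuous aM) (haMs : HasCompactSupport aM)
    (C : ℝ) (hC : 0 < C)
    (hplus : ∀ (x p : Fin (n+1) → ℝ) (σ : ℝ), 0 < σ →
      ‖a (0, x, x, p) σ - aP (x, p)‖ ≤ C * (1 + σ)⁻¹)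
    (hminus : ∀ (x p : Fin (n+1) → ℝ) (σ : ℝ), σ < 0 →
      ‖a (0, x, x, p) σ - aM (x, p)‖ ≤ C * (1 + |σ|)⁻¹) :
    ∃ C' > (0 : ℝ), ∃ ℏ₀ : ℝ, 0 < ℏ₀ ∧ ℏ₀ < 1 ∧ ∀ ℏ : ℝ, 0 < ℏ → ℏ ≤ ℏ₀ →
      ‖(∫ x : Fin (n+1) → ℝ, uh n 0 a ℏ x x) -
          Complex.ofReal ((2 * π) ^ (1 - ((n : ℝ) + 1)) * ℏ ^ (-((n : ℝ) + 1))) *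
            ∫ xp : (Fin (n+1) → ℝ) × (Fin (n+1) → ℝ),
              (if 0 < xp.2 0 then aP xp else if xp.2 0 < 0 then aM xp else 0)‖
        ≤ C' * ℏ ^ (-((n : ℝ) + 1) + 1) * Real.log (1 / ℏ) := by
  obtain ⟨M, R0, hMR⟩ := good_of_amp n a ha
  obtain ⟨R1, hR1⟩ := haPs.isCompact.isBounded.exists_norm_le
  obtain ⟨R2, hR2⟩ := haMs.isCompact.isBounded.exists_norm_le
  set R : ℝ := 1 + |R0| + |R1| + |R2| with hRdef
  have hRp : 0 < R := by positivity
  have hR0 : R0 ≤ R := by linarith [le_abs_self R0, abs_nonneg R1, abs_nonneg R2]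
  have hR1' : R1 ≤ R := by linarith [le_abs_self R1, abs_nonneg R0, abs_nonneg R2]
  have hR2' : R2 ≤ R := by linarith [le_abs_self R2, abs_nonneg R1, abs_nonneg R0]
  obtain ⟨hG, hz⟩ := hMR R hR0 hRp
  have hM := good_M (hG 0 0)
  have hpi := pi_pos
  have hPz : ∀ xp, R < ‖xp‖ → aP xp = 0 := by
    intro xp hxp
    by_contra hne
    linarith [hR1 xp (subset_tsupport _ hne)]
  have hMz : ∀ xp, R < ‖xp‖ → aM xp = 0 := by
    intro xp hxp
    by_contra hne
    linarith [hR2 xp (subset_tsupport _ hne)]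
  set A : (Fin (n+1) → ℝ) × (Fin (n+1) → ℝ) → ℂ := fun xp =>
    (if 0 < xp.2 0 then aP xp else if xp.2 0 < 0 then aM xp else 0) with hA
  have hAz : ∀ xp, R < ‖xp‖ → A xp = 0 := by
    intro xp hxp
    simp [hA, hPz xp hxp, hMz xp hxp]
  have hAmeas : Measurable A := by
    refine Measurable.ite ?_ haPc.measurable (Measurable.ite ?_ haMc.measurable measurable_const)
    · exact measurableSet_lt measurable_const (by fun_prop)
    · exact measurableSet_lt (by fun_prop) measurable_const
  have hAint : Integrable A := by
    refine ((haPc.integrable_of_hasCompactSupport haPs).norm.add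
      (haMc.integrable_of_hasCompactSupport haMs).norm).mono' hAmeas.aestronglyMeasurable ?_
    refine Filter.Eventually.of_forall fun xp => ?_
    simp only [hA, Pi.add_apply]
    split_ifs
    · linarith [norm_nonneg (aM xp)]
    · linarith [norm_nonneg (aP xp)]
    · simp only [norm_zero]; positivity
  set J : ℝ := ∫ ξ : ℝ, (1 + (2 * π * ξ) ^ 2)⁻¹ with hJ
  have hJ0 : 0 ≤ J := integral_nonneg fun ξ => by positivity
  set D : ℝ := 2 * π * (16 * R * M * J) + 2 * π * (C + M) with hD
  have hD0 : 0 ≤ D := by positivity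
  set B : (Fin (n+1) → ℝ) → ℝ :=
    (Metric.closedBall (0 : Fin (n+1) → ℝ) R).indicator (fun _ => (1 : ℝ)) with hB
  have hBint : Integrable B := by
    rw [hB, integrable_indicator_iff Metric.isClosed_closedBall.measurableSet]
    exact integrableOn_const (measure_closedBall_lt_top.ne)
  have hB0 : ∀ x, 0 ≤ B x := fun x => Set.indicator_nonneg (fun _ _ => zero_le_one) x
  have hVB : 0 ≤ ∫ x, B x := integral_nonneg hB0
  -- pointwise estimate
  have point : ∀ ℏ : ℝ, 0 < ℏ → ∀ xp : (Fin (n+1) → ℝ) × (Fin (n+1) → ℝ),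
      ‖(∫ σ : ℝ, ∫ s : ℝ, Hd n a ℏ⁻¹ xp.1 xp.2 σ s) - 2 * π * A xp‖
        ≤ D * (B xp.1 * wt n ℏ⁻¹ R xp.2) := by
    intro ℏ hℏ xp
    obtain ⟨x, p⟩ := xp
    by_cases hout : R < ‖x‖ ∨ R < ‖p‖
    · have h1 : A (x, p) = 0 := by
        apply hAz
        rw [Prod.norm_def]
        exact lt_sup_iff.mpr hout
      have h2 : ∀ σ s, Hd n a ℏ⁻¹ x p σ s = 0 := fun σ s =>
        Hd_zero n a _ x p σ s (fun s => hz s x p σ hout)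
      simp only [h1, h2, integral_zero, mul_zero, sub_zero, norm_zero]
      exact mul_nonneg hD0 (mul_nonneg (hB0 _) (wt_nonneg _ _ _ _))
    · push Not at hout
      have hx : B x = 1 := by
        rw [hB, Set.indicator_of_mem]
        simpa using hout.1
      simp only
      rw [hx, wt_eq n _ R p hout.2, one_mul]
      have h3 : (∫ σ : ℝ, ∫ s : ℝ, Hd n a ℏ⁻¹ x p σ s)
          = ∫ σ, 𝓕 (fun s => a (s, x, x, p) σ) ((ℏ⁻¹ * p 0 - σ) / (2 * π)) := by
        congr 1; ext σ
        exact mod_fourier (hG x p) ℏ⁻¹ (p 0) σ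
      have h4 := one_dim hRp (hG x p) (ℏ⁻¹ * p 0)
      rw [h3]
      have h5 : ‖a (0, x, x, p) (ℏ⁻¹ * p 0) - A (x, p)‖ ≤ (C + M) * (1 + |ℏ⁻¹ * p 0|)⁻¹ := by
        have hw : 0 ≤ (1 + |ℏ⁻¹ * p 0|)⁻¹ := by positivity
        rcases lt_trichotomy (p 0) 0 with hp | hp | hp
        · have hs : ℏ⁻¹ * p 0 < 0 := mul_neg_of_pos_of_neg (inv_pos.mpr hℏ) hp
          have e : A (x, p) = aM (x, p) := by simp [hA, hp, hp.le]
          rw [e]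
          refine (hminus x p _ hs).trans ?_
          gcongr; linarith
        · have e : A (x, p) = 0 := by simp [hA, hp]
          rw [e, hp]
          have := (hG x p).2.2.1 0 (by simp) 0 (ℏ⁻¹ * 0)
          rw [iteratedDeriv_zero] at this
          simp only [sub_zero, mul_zero, abs_zero, add_zero, inv_one, mul_one] at this ⊢
          linarith
        · have hs : 0 < ℏ⁻¹ * p 0 := mul_pos (inv_pos.mpr hℏ) hp
          have e : A (x, p) = aP (x, p) := by simp [hA, hp]
          rw [e]
          refine (hplus x p _ hs).trans ?_
          rw [abs_of_pos hs]
          gcongr; linarith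
      have hn : ‖2 * (π : ℂ)‖ = 2 * π := by simp [abs_of_pos hpi]
      have h6 : ‖2 * (π : ℂ) * a (0, x, x, p) (ℏ⁻¹ * p 0) - 2 * π * A (x, p)‖
          ≤ 2 * π * ((C + M) * (1 + |ℏ⁻¹ * p 0|)⁻¹) := by
        rw [← mul_sub, norm_mul, hn]
        gcongr
      refine (norm_sub_le_norm_sub_add_norm_sub _ (2 * (π : ℂ) * a (0, x, x, p) (ℏ⁻¹ * p 0)) _).trans ?_
      rw [div_eq_mul_inv] at h4
      calc _ ≤ _ := add_le_add h4 h6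
        _ = _ := by rw [hD]; ring
  set E : ℝ := (2 * π) ^ (-((n : ℝ) + 1)) * D * (∫ x, B x) * (2 * (2 * R) ^ n * (Real.log (1 + R) + 1)) with hE
  have hlogR : 0 ≤ Real.log (1 + R) := Real.log_nonneg (by linarith)
  have hE0 : 0 ≤ E := by positivity
  refine ⟨E + 1, by linarith, Real.exp (-1), Real.exp_pos _, by
    rw [Real.exp_lt_one_iff]; norm_num, ?_⟩
  intro ℏ hℏ hℏ1
  have hlog1 : 1 ≤ Real.log (1 / ℏ) := by
    rw [one_div, Real.log_inv]
    have := Real.log_le_log hℏ hℏ1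
    rw [Real.log_exp] at this
    linarith
  have hℏlt : ℏ ≤ 1 := hℏ1.trans (by rw [Real.exp_le_one_iff]; norm_num)
  set L : (Fin (n+1) → ℝ) × (Fin (n+1) → ℝ) → ℂ := fun xp =>
    ∫ σ : ℝ, ∫ s : ℝ, Hd n a ℏ⁻¹ xp.1 xp.2 σ s with hL
  have hwint : Integrable fun xp : (Fin (n+1) → ℝ) × (Fin (n+1) → ℝ) =>
      D * (B xp.1 * wt n ℏ⁻¹ R xp.2) :=
    (hBint.mul_prod (wt_integrable n ℏ⁻¹ R)).const_mul D
  have hdint : Integrable fun xp => L xp - 2 * π * A xp := by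
    refine hwint.mono' ?_ (Filter.Eventually.of_forall (point ℏ hℏ))
    exact (L_meas n a ha ℏ⁻¹).sub (hAint.const_mul _).aestronglyMeasurable
  have hLint : Integrable L := by
    have := hdint.add (hAint.const_mul (2 * (π : ℂ)))
    refine this.congr (Filter.Eventually.of_forall fun xp => ?_)
    simp
  have huh : (∫ x : Fin (n+1) → ℝ, uh n 0 a ℏ x x)
      = Complex.ofReal ((2 * π * ℏ) ^ (-((n : ℤ) + 1))) * ∫ xp, L xp := by
    simp only [uh_eq n a ha ℏ R M hG hz]
    rw [integral_const_mul]
    congr 1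
    rw [Measure.volume_eq_prod] at hLint ⊢
    rw [integral_prod _ hLint]
  have hpow : (2 * π * ℏ) ^ (-((n : ℤ) + 1)) = (2 * π) ^ (-((n : ℝ) + 1)) * ℏ ^ (-((n : ℝ) + 1)) := by
    rw [← Real.mul_rpow (by positivity) hℏ.le, ← Real.rpow_intCast]
    push_cast; rfl
  have hpow2 : (2 * π) ^ (1 - ((n : ℝ) + 1)) = (2 * π) ^ (-((n : ℝ) + 1)) * (2 * π) := by
    rw [sub_eq_neg_add, Real.rpow_add (by positivity), Real.rpow_one]
  have hdiff : (∫ x : Fin (n+1) → ℝ, uh n 0 a ℏ x x) -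
          Complex.ofReal ((2 * π) ^ (1 - ((n : ℝ) + 1)) * ℏ ^ (-((n : ℝ) + 1))) * ∫ xp, A xp
      = Complex.ofReal ((2 * π) ^ (-((n : ℝ) + 1)) * ℏ ^ (-((n : ℝ) + 1))) *
        ∫ xp, (L xp - 2 * π * A xp) := by
    rw [huh, integral_sub hLint (hAint.const_mul _), integral_const_mul, hpow, hpow2]
    push_cast; ring
  rw [hdiff, norm_mul, Complex.norm_real, norm_eq_abs, abs_of_nonneg (by positivity)]
  have hI : ‖∫ xp, (L xp - 2 * π * A xp)‖ ≤ D * ((∫ x, B x) * (2 * (Real.log (1 + ℏ⁻¹ * R) / ℏ⁻¹) * (2 * R) ^ n)) := by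
    refine (norm_integral_le_of_norm_le hwint (Filter.Eventually.of_forall (point ℏ hℏ))).trans (le_of_eq ?_)
    rw [integral_const_mul, Measure.volume_eq_prod, integral_prod_mul, wt_integral n _ R (inv_pos.mpr hℏ) hRp]
  have hlog : Real.log (1 + ℏ⁻¹ * R) ≤ (Real.log (1 + R) + 1) * Real.log (1 / ℏ) := by
    have h1 : 1 + ℏ⁻¹ * R ≤ (1 + R) * (1 / ℏ) := by
      have : 1 ≤ ℏ⁻¹ := (one_le_inv₀ hℏ).mpr hℏlt
      rw [one_div]; nlinarith
    calc _ ≤ Real.log ((1 + R) * (1 / ℏ)) := Real.log_le_log (by positivity) h1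
      _ = Real.log (1 + R) + Real.log (1 / ℏ) := Real.log_mul (by positivity) (by positivity)
      _ ≤ _ := by nlinarith
  have hpow3 : ℏ ^ (-((n : ℝ) + 1) + 1) = ℏ ^ (-((n : ℝ) + 1)) * ℏ := by
    rw [Real.rpow_add hℏ, Real.rpow_one]
  rw [hpow3]
  calc _ ≤ (2 * π) ^ (-((n : ℝ) + 1)) * ℏ ^ (-((n : ℝ) + 1)) *
        (D * ((∫ x, B x) * (2 * (Real.log (1 + ℏ⁻¹ * R) / ℏ⁻¹) * (2 * R) ^ n))) := by gcongr
    _ ≤ (2 * π) ^ (-((n : ℝ) + 1)) * ℏ ^ (-((n : ℝ) + 1)) *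
        (D * ((∫ x, B x) * (2 * ((Real.log (1 + R) + 1) * Real.log (1 / ℏ) / ℏ⁻¹) * (2 * R) ^ n))) := by gcongr
    _ = E * (ℏ ^ (-((n : ℝ) + 1)) * ℏ) * Real.log (1 / ℏ) := by
        rw [hE, div_inv_eq_mul]; ring
    _ ≤ (E + 1) * (ℏ ^ (-((n : ℝ) + 1)) * ℏ) * Real.log (1 / ℏ) := by
        gcongr; linarith
end
end
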